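/- For every ranked alphabet Σ and every k ≥ 1, the family DPTWA^k of tree languages over Σ accepted by deterministic k-head tree-walking automata with nested pebbles is closed under complement (within T_Σ) and under union. -/

import Mathlib

namespace NestedPebbles

/-- Trees over a ranked alphabet `(Sig, rank)`: terms `σ(t₁,…,tₙ)` with `rank σ = n`. -/
inductive RTree (Sig : Type) (rank : Sig → ℕ) : Type
  | node (a : Sig) (children : Fin (rank a) → RTree Sig rank) : RTree Sig rank

namespace RTree

variable {Sig : Type} {rank : Sig → ℕ}

/-- The label of the root symbol. -/
def label : RTree Sig rank → Sig
  | node a _ => a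

/-- The `i`-th (0-based) immediate subtree, if it exists. -/
def child : RTree Sig rank → ℕ → Option (RTree Sig rank)
  | node a c, i => if h : i < rank a then some (c ⟨i, h⟩) else none

/-- The subtree at a position (a list of 0-based child indices, read from the root). -/
def subtree : RTree Sig rank → List ℕ → Option (RTree Sig rank)
  | t, [] => some t
  | t, i :: p => (t.child i).bind fun s => s.subtree p

end RTree

variable {Sig : Type} {rank : Sig → ℕ}

/-- `p` is (the address of) a node of `t`. -/
def IsPos (t : RTree Sig rank) (p : List ℕ) : Prop := (t.subtree p).isSome = true

/-- The type of nodes of a tree `t`, as valid positions. -/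
def Pos (t : RTree Sig rank) : Type := { p : List ℕ // IsPos t p }

/-- The root node. -/
def rootPos (t : RTree Sig rank) : Pos t := ⟨[], rfl⟩

/-- The label of the node of `t` at position `p`. -/
def labelAt (t : RTree Sig rank) (p : List ℕ) : Option Sig := (t.subtree p).map RTree.label

/-- The child number of a node: `0` for the root, and `j` for a `j`-th child (1-based). -/
def childNo (p : List ℕ) : ℕ :=
  match p.getLast? with
  | none => 0
  | some j => j + 1

/-!  ### First-order logic with k-ary transitive closure, on trees  -/

/-- First-order formulas over a ranked alphabet, with a `k`-ary transitive closure
operator.  Variables are natural numbers.  `lab a x` means `x` has label `a`;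
`edg i x y` means `y` is the `i`-th child of `x` (`i` is 1-based);
`le x y` means `x` is an ancestor of `y`; `tc xs ys φ us vs` is the transitive
closure `φ*` of `φ` with respect to the tuples of variables `xs`, `ys` (which it
binds), applied to the tuples of variables `us`, `vs`. -/
inductive TForm (Sig : Type) (rank : Sig → ℕ) (k : ℕ) : Type
  | lab (a : Sig) (x : ℕ)
  | edg (i : ℕ) (x y : ℕ)
  | le (x y : ℕ)
  | eq (x y : ℕ)
  | not (φ : TForm Sig rank k)
  | and (φ ψ : TForm Sig rank k)
  | or (φ ψ : TForm Sig rank k)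
  | ex (x : ℕ) (φ : TForm Sig rank k)
  | all (x : ℕ) (φ : TForm Sig rank k)
  | tc (xs ys : Fin k → ℕ) (φ : TForm Sig rank k) (us vs : Fin k → ℕ)

/-- Update a valuation on a tuple of variables simultaneously. -/
noncomputable def updVec {α : Type} {k : ℕ} (ν : ℕ → α) (xs : Fin k → ℕ) (a : Fin k → α) :
    ℕ → α :=
  fun n => if h : ∃ i, xs i = n then a h.choose else ν n

/-- Satisfaction of a formula in a tree `t` under a valuation of the variables by
nodes of `t`. -/
def Sat {k : ℕ} (t : RTree Sig rank) : TForm Sig rank k → (ℕ → Pos t) → Prop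
  | .lab a x, ν => labelAt t (ν x).1 = some a
  | .edg i x y, ν => 1 ≤ i ∧ (ν y).1 = (ν x).1 ++ [i - 1]
  | .le x y, ν => (ν x).1 <+: (ν y).1
  | .eq x y, ν => ν x = ν y
  | .not φ, ν => ¬ Sat t φ ν
  | .and φ ψ, ν => Sat t φ ν ∧ Sat t ψ ν
  | .or φ ψ, ν => Sat t φ ν ∨ Sat t ψ ν
  | .ex x φ, ν => ∃ u : Pos t, Sat t φ (Function.update ν x u)
  | .all x φ, ν => ∀ u : Pos t, Sat t φ (Function.update ν x u)
  | .tc xs ys φ us vs, ν =>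
      Relation.ReflTransGen
        (fun a b : Fin k → Pos t => Sat t φ (updVec (updVec ν xs a) ys b))
        (fun i => ν (us i)) (fun i => ν (vs i))

/-- The free variables of a formula. -/
def freeVars {k : ℕ} : TForm Sig rank k → Set ℕ
  | .lab _ x => {x}
  | .edg _ x y => {x, y}
  | .le x y => {x, y}
  | .eq x y => {x, y}
  | .not φ => freeVars φ
  | .and φ ψ => freeVars φ ∪ freeVars ψ
  | .or φ ψ => freeVars φ ∪ freeVars ψ
  | .ex x φ => freeVars φ \ {x}
  | .all x φ => freeVars φ \ {x}
  | .tc xs ys φ us vs =>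
      (freeVars φ \ (Set.range xs ∪ Set.range ys)) ∪ Set.range us ∪ Set.range vs

/-- Two `k`-tuples of variables consist of `2k` pairwise distinct variables. -/
def Distinct2 {k : ℕ} (xs ys : Fin k → ℕ) : Prop :=
  Function.Injective xs ∧ Function.Injective ys ∧ ∀ i j, xs i ≠ ys j

/-- `φ` is functional in the tuples of variables `xs`, `ys`: for every tree, every
valuation of the remaining variables, and every value of `xs`, there is at most one
value of `ys` satisfying `φ`. -/
def FunctionalIn {k : ℕ} (φ : TForm Sig rank k) (xs ys : Fin k → ℕ) : Prop :=
  ∀ (t : RTree Sig rank) (ν : ℕ → Pos t) (a b b' : Fin k → Pos t),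
    Sat t φ (updVec (updVec ν xs a) ys b) →
    Sat t φ (updVec (updVec ν xs a) ys b') → b = b'

/-- Well-formedness: in each transitive closure the `2k` bound variables are
pairwise distinct and occur free in the body. -/
def WF {k : ℕ} : TForm Sig rank k → Prop
  | .not φ => WF φ
  | .and φ ψ => WF φ ∧ WF ψ
  | .or φ ψ => WF φ ∧ WF ψ
  | .ex _ φ => WF φ
  | .all _ φ => WF φ
  | .tc xs ys φ _ _ =>
      Distinct2 xs ys ∧ (Set.range xs ∪ Set.range ys) ⊆ freeVars φ ∧ WF φ
  | _ => True

/-- All transitive closures occurring in the formula are deterministic, i.e., applied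
to functional formulas. -/
def DetTC {k : ℕ} : TForm Sig rank k → Prop
  | .not φ => DetTC φ
  | .and φ ψ => DetTC φ ∧ DetTC ψ
  | .or φ ψ => DetTC φ ∧ DetTC ψ
  | .ex _ φ => DetTC φ
  | .all _ φ => DetTC φ
  | .tc xs ys φ _ _ => FunctionalIn φ xs ys ∧ DetTC φ
  | _ => True

/-- All occurrences of transitive closure are positive (within the scope of an even
number of negations); the polarity parameter `b` is `true` for an even number. -/
def PosTC {k : ℕ} : Bool → TForm Sig rank k → Prop
  | b, .not φ => PosTC (!b) φ
  | b, .and φ ψ => PosTC b φ ∧ PosTC b ψ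
  | b, .or φ ψ => PosTC b φ ∧ PosTC b ψ
  | b, .ex _ φ => PosTC b φ
  | b, .all _ φ => PosTC b φ
  | b, .tc _ _ φ _ _ => b = true ∧ PosTC b φ
  | _, _ => True

/-- The formula contains no transitive closure operator (pure first-order). -/
def TCFree {k : ℕ} : TForm Sig rank k → Prop
  | .not φ => TCFree φ
  | .and φ ψ => TCFree φ ∧ TCFree ψ
  | .or φ ψ => TCFree φ ∧ TCFree ψ
  | .ex _ φ => TCFree φ
  | .all _ φ => TCFree φ
  | .tc _ _ _ _ _ => False
  | _ => True

/-- The tree language defined by a (closed) formula. -/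
def treesOf {k : ℕ} (φ : TForm Sig rank k) : Set (RTree Sig rank) :=
  {t | Sat t φ fun _ => rootPos t}

/-- `FO+DTC^k`: tree languages definable by closed first-order formulas with `k`-ary
deterministic transitive closure. -/
def FODTC (Sig : Type) (rank : Sig → ℕ) (k : ℕ) : Set (Set (RTree Sig rank)) :=
  {L | ∃ φ : TForm Sig rank k, WF φ ∧ DetTC φ ∧ freeVars φ = ∅ ∧ L = treesOf φ}

/-- `FO+TC^k`: tree languages definable by closed first-order formulas with `k`-ary
transitive closure. -/
def FOTC (Sig : Type) (rank : Sig → ℕ) (k : ℕ) : Set (Set (RTree Sig rank)) :=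
  {L | ∃ φ : TForm Sig rank k, WF φ ∧ freeVars φ = ∅ ∧ L = treesOf φ}

/-- `FO+posTC^k`: tree languages definable by closed first-order formulas in which
every occurrence of the `k`-ary transitive closure operator is positive. -/
def FOposTC (Sig : Type) (rank : Sig → ℕ) (k : ℕ) : Set (Set (RTree Sig rank)) :=
  {L | ∃ φ : TForm Sig rank k, WF φ ∧ PosTC true φ ∧ freeVars φ = ∅ ∧ L = treesOf φ}

/-!  ### k-head tree-walking automata with nested pebbles  -/

/-- Tests of a `k`-head tree-walking automaton with pebble set `X`:
label of the node under head `i`, presence of pebble `x` at head `i`, and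
child number of the node under head `i`. -/
inductive TTest (Sig : Type) (k : ℕ) (X : Type) : Type
  | lab (i : Fin k) (a : Sig)
  | peb (i : Fin k) (x : X)
  | chno (i : Fin k) (j : ℕ)

/-- Instructions: move head `i` up / down to the `j`-th child (1-based), drop a
pebble at head `i`, retrieve the most recently dropped pebble (from a distance),
or perform a positive (`b = true`) or negated (`b = false`) test. -/
inductive TInstr (Sig : Type) (k : ℕ) (X : Type) : Type
  | up (i : Fin k)
  | down (i : Fin k) (j : ℕ)
  | dropPeb (i : Fin k) (x : X)
  | retrieve (x : X)
  | test (b : Bool) (τ : TTest Sig k X)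

/-- A `k`-head tree-walking automaton with nested pebbles: a finite state set `Q`,
a finite pebble set `X`, an initial state, accepting states, and a finite set of
instructions `⟨p, χ, q⟩`. -/
structure TWA (Sig : Type) (rank : Sig → ℕ) (k : ℕ) : Type 1 where
  Q : Type
  finQ : Fintype Q
  X : Type
  finX : Fintype X
  q0 : Q
  acc : Set Q
  instr : Set (Q × TInstr Sig k X × Q)
  instrFin : instr.Finite

/-- Configurations: a state, the positions of the `k` heads, and the stack of
dropped pebbles with their positions (most recent first). -/
abbrev TConf {Sig : Type} {rank : Sig → ℕ} {k : ℕ} (A : TWA Sig rank k)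
    (t : RTree Sig rank) : Type :=
  A.Q × (Fin k → Pos t) × List (A.X × Pos t)

/-- Semantics of tests. -/
def testHolds {k : ℕ} (t : RTree Sig rank) {X : Type} (τ : TTest Sig k X)
    (hs : Fin k → Pos t) (π : List (X × Pos t)) : Prop :=
  match τ with
  | .lab i a => labelAt t (hs i).1 = some a
  | .peb i x => (x, hs i) ∈ π
  | .chno i j => childNo (hs i).1 = j

/-- Semantics of a single instruction, relating head positions and pebble stacks
before and after. -/
def instrStep {k : ℕ} (t : RTree Sig rank) {X : Type} (ins : TInstr Sig k X)
    (hs : Fin k → Pos t) (π : List (X × Pos t))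
    (hs' : Fin k → Pos t) (π' : List (X × Pos t)) : Prop :=
  match ins with
  | .up i => π' = π ∧ (∃ j : ℕ, (hs i).1 = (hs' i).1 ++ [j]) ∧ ∀ h, h ≠ i → hs' h = hs h
  | .down i j => π' = π ∧ 1 ≤ j ∧ (hs' i).1 = (hs i).1 ++ [j - 1] ∧ ∀ h, h ≠ i → hs' h = hs h
  | .dropPeb i x => hs' = hs ∧ π' = (x, hs i) :: π ∧ ∀ w, (x, w) ∉ π
  | .retrieve x => hs' = hs ∧ ∃ w, π = (x, w) :: π'
  | .test b τ => hs' = hs ∧ π' = π ∧ (testHolds t τ hs π ↔ b = true)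

/-- The step relation of automaton `A` on tree `t`. -/
def Step {k : ℕ} (A : TWA Sig rank k) (t : RTree Sig rank) :
    TConf A t → TConf A t → Prop :=
  fun c c' => ∃ ins : TInstr Sig k A.X,
    (c.1, ins, c'.1) ∈ A.instr ∧ instrStep t ins c.2.1 c.2.2 c'.2.1 c'.2.2

/-- `χ'` is the negation of the test `χ`. -/
def negOf {k : ℕ} {X : Type} (χ χ' : TInstr Sig k X) : Prop :=
  ∃ b τ, χ = TInstr.test b τ ∧ χ' = TInstr.test (!b) τ

/-- Determinism: any two distinct instructions with the same source state consist
of a test and its negation. -/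
def Deterministic {k : ℕ} (A : TWA Sig rank k) : Prop :=
  ∀ p χ₁ q₁ χ₂ q₂, (p, χ₁, q₁) ∈ A.instr → (p, χ₂, q₂) ∈ A.instr →
    (χ₁, q₁) ≠ (χ₂, q₂) → negOf χ₁ χ₂ ∨ negOf χ₂ χ₁

/-- The initial configuration: initial state, all heads at the root, no pebbles. -/
def initConf {k : ℕ} (A : TWA Sig rank k) (t : RTree Sig rank) : TConf A t :=
  (A.q0, fun _ => rootPos t, [])

/-- A configuration is halting if no step is possible from it. -/
def HaltingConf {k : ℕ} (A : TWA Sig rank k) (t : RTree Sig rank) (c : TConf A t) : Prop :=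
  ∀ c', ¬ Step A t c c'

/-- Acceptance: some computation from the initial configuration halts in an
accepting state with all heads at the root and no pebbles on the tree. -/
def Accepts {k : ℕ} (A : TWA Sig rank k) (t : RTree Sig rank) : Prop :=
  ∃ q ∈ A.acc,
    Relation.ReflTransGen (Step A t) (initConf A t) (q, fun _ => rootPos t, []) ∧
    HaltingConf A t (q, fun _ => rootPos t, [])

/-- The tree language accepted by `A`. -/
def Lang {k : ℕ} (A : TWA Sig rank k) : Set (RTree Sig rank) := {t | Accepts A t}

/-- The automaton uses no pebbles at all. -/
def PebbleFree {k : ℕ} (A : TWA Sig rank k) : Prop :=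
  ∀ p χ q, (p, χ, q) ∈ A.instr →
    (∀ i x, χ ≠ TInstr.dropPeb i x) ∧ (∀ x, χ ≠ TInstr.retrieve x) ∧
    (∀ b i x, χ ≠ TInstr.test b (TTest.peb i x))

/-- `DPTWA^k`: tree languages accepted by deterministic `k`-head tree-walking
automata with nested pebbles. -/
def DPTWA (Sig : Type) (rank : Sig → ℕ) (k : ℕ) : Set (Set (RTree Sig rank)) :=
  {L | ∃ A : TWA Sig rank k, Deterministic A ∧ L = Lang A}

/-- `NPTWA^k`: tree languages accepted by nondeterministic `k`-head tree-walking
automata with nested pebbles. -/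
def NPTWA (Sig : Type) (rank : Sig → ℕ) (k : ℕ) : Set (Set (RTree Sig rank)) :=
  {L | ∃ A : TWA Sig rank k, L = Lang A}

/-- `NTWA^k`: tree languages accepted by nondeterministic `k`-head tree-walking
automata without pebbles. -/
def NTWA (Sig : Type) (rank : Sig → ℕ) (k : ℕ) : Set (Set (RTree Sig rank)) :=
  {L | ∃ A : TWA Sig rank k, PebbleFree A ∧ L = Lang A}

end NestedPebbles

namespace NestedPebbles

/-! ### Gadgets: deterministic automaton fragments with exits -/

/-- Commands of a gadget; the pebbles are numbered by their position in the stack. -/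
inductive Cmd (Sig : Type) (k : ℕ) (α : Type) : Type
  | up (i : Fin k) (a : α)
  | down (i : Fin k) (j : ℕ) (a : α)
  | drop (i : Fin k) (x : ℕ) (a : α)
  | retr (x : ℕ) (a : α)
  | test (τ : TTest Sig k ℕ) (a b : α)

def Cmd.map {Sig : Type} {k : ℕ} {α β : Type} (f : α → β) : Cmd Sig k α → Cmd Sig k β
  | .up i a => .up i (f a)
  | .down i j a => .down i j (f a)
  | .drop i x a => .drop i x (f a)
  | .retr x a => .retr x (f a)
  | .test τ a b => .test τ (f a) (f b)

section gadgets
variable {Sig : Type} {rank : Sig → ℕ} {k : ℕ}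

/-- Semantics of tests, with the pebble stack as a list of positions (bottom first). -/
def THolds (t : RTree Sig rank) (τ : TTest Sig k ℕ) (hs : Fin k → Pos t) (π : List (Pos t)) :
    Prop :=
  match τ with
  | .lab i a => labelAt t (hs i).1 = some a
  | .peb i x => π[x]? = some (hs i)
  | .chno i j => childNo (hs i).1 = j

abbrev GC (k : ℕ) (t : RTree Sig rank) : Type := (Fin k → Pos t) × List (Pos t)

inductive CStep (t : RTree Sig rank) {α : Type} : Cmd Sig k α → GC k t → α → GC k t → Prop
  | up {i a hs π p j} : (hs i).1 = p.1 ++ [j] →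
      CStep t (.up i a) (hs, π) a (Function.update hs i p, π)
  | down {i j a hs π p} : 1 ≤ j → p.1 = (hs i).1 ++ [j - 1] →
      CStep t (.down i j a) (hs, π) a (Function.update hs i p, π)
  | drop {i x a hs π} : π.length = x → CStep t (.drop i x a) (hs, π) a (hs, π ++ [hs i])
  | retr {x a hs π u} : π.length = x → CStep t (.retr x a) (hs, π ++ [u]) a (hs, π)
  | testT {τ a b hs π} : THolds t τ hs π → CStep t (.test τ a b) (hs, π) a (hs, π)
  | testF {τ a b hs π} : ¬ THolds t τ hs π → CStep t (.test τ a b) (hs, π) b (hs, π)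

theorem CStep.map {t : RTree Sig rank} {α β : Type} (f : α → β) {c : Cmd Sig k α} {x y : GC k t}
    {a : α} (h : CStep t c x a y) : CStep t (c.map f) x (f a) y := by
  cases h with
  | up h => exact .up h
  | down h h' => exact .down h h'
  | drop h => exact .drop h
  | retr h => exact .retr h
  | testT h => exact .testT h
  | testF h => exact .testF h

structure Gadget (Sig : Type) (k : ℕ) (E : Type) : Type 1 where
  Q : Type
  fin : Finite Q
  entry : Q
  prog : Q → Cmd Sig k (Q ⊕ E)

inductive GStep {E : Type} (G : Gadget Sig k E) (t : RTree Sig rank) :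
    (G.Q ⊕ E) × GC k t → (G.Q ⊕ E) × GC k t → Prop
  | mk {q x a y} : CStep t (G.prog q) x a y → GStep G t (Sum.inl q, x) (a, y)

def Gadget.Run {E : Type} (G : Gadget Sig k E) (t : RTree Sig rank) (x : GC k t) (e : E)
    (y : GC k t) : Prop :=
  Relation.ReflTransGen (GStep G t) (Sum.inl G.entry, x) (Sum.inr e, y)

theorem GStep.embed {E E' : Type} {G : Gadget Sig k E} {K : Gadget Sig k E'}
    {t : RTree Sig rank}
    (f : G.Q ⊕ E → K.Q ⊕ E')
    (hf : ∀ q, ∃ q', f (Sum.inl q) = Sum.inl q' ∧ K.prog q' = (G.prog q).map f)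
    {x y : (G.Q ⊕ E) × GC k t} (h : Relation.ReflTransGen (GStep G t) x y) :
    Relation.ReflTransGen (GStep K t) (f x.1, x.2) (f y.1, y.2) := by
  induction h with
  | refl => exact .refl
  | tail _ h ih =>
    refine ih.tail ?_
    cases h with
    | @mk q x a y h =>
      obtain ⟨q', h1, h2⟩ := hf q
      simp only [h1]
      refine GStep.mk ?_
      rw [h2]
      exact h.map f

/-- Single command. -/
def prim {E : Type} (c : Cmd Sig k E) : Gadget Sig k E where
  Q := Unit
  fin := inferInstance
  entry := ()
  prog _ := c.map Sum.inr

theorem prim_run {E : Type} {c : Cmd Sig k E} {t : RTree Sig rank} {x y : GC k t} {e : E}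
    (h : CStep t c x e y) : (prim c).Run t x e y :=
  .single (GStep.mk (h.map Sum.inr))

def pureG [NeZero k] {E : Type} (e : E) : Gadget Sig k E := prim (.test (.chno 0 0) e e)

theorem pureG_run [NeZero k] {E : Type} {e : E} {t : RTree Sig rank} {x : GC k t} :
    (pureG e : Gadget Sig k E).Run t x e x := by
  obtain ⟨hs, π⟩ := x
  by_cases h : THolds t (.chno 0 0 : TTest Sig k ℕ) hs π
  · exact prim_run (.testT h)
  · exact prim_run (.testF h)

/-- Sequential composition. -/
def Gadget.bind {E E' : Type} [Finite E] (G : Gadget Sig k E) (H : E → Gadget Sig k E') :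
    Gadget Sig k E' where
  Q := G.Q ⊕ Σ e, (H e).Q
  fin := by
    have := G.fin
    have := fun e => (H e).fin
    infer_instance
  entry := Sum.inl G.entry
  prog
    | Sum.inl q => (G.prog q).map
        (Sum.elim (fun q => Sum.inl (Sum.inl q)) (fun e => Sum.inl (Sum.inr ⟨e, (H e).entry⟩)))
    | Sum.inr ⟨e, q⟩ => ((H e).prog q).map
        (Sum.elim (fun q => Sum.inl (Sum.inr ⟨e, q⟩)) Sum.inr)

theorem bind_run {E E' : Type} [Finite E] {G : Gadget Sig k E} {H : E → Gadget Sig k E'}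
    {t : RTree Sig rank} {x y z : GC k t} {e : E} {e' : E'}
    (h1 : G.Run t x e y) (h2 : (H e).Run t y e' z) : (G.bind H).Run t x e' z := by
  have a1 := GStep.embed (K := G.bind H)
    (Sum.elim (fun q => Sum.inl (Sum.inl q)) (fun e => Sum.inl (Sum.inr ⟨e, (H e).entry⟩)))
    (fun q => ⟨Sum.inl q, rfl, rfl⟩) h1
  have a2 := GStep.embed (K := G.bind H)
    (Sum.elim (fun q => Sum.inl (Sum.inr ⟨e, q⟩)) Sum.inr)
    (fun q => ⟨Sum.inr ⟨e, q⟩, rfl, rfl⟩) h2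
  exact a1.trans a2

/-- Loops. -/
def loop {M E : Type} [Finite M] (G : M → Gadget Sig k (M ⊕ E)) (m : M) : Gadget Sig k E where
  Q := Σ m, (G m).Q
  fin := by
    have := fun e => (G e).fin
    infer_instance
  entry := ⟨m, (G m).entry⟩
  prog
    | ⟨m, q⟩ => ((G m).prog q).map
        (Sum.elim (fun q => Sum.inl ⟨m, q⟩)
          (Sum.elim (fun m' => Sum.inl ⟨m', (G m').entry⟩) Sum.inr))

theorem loop_exit {M E : Type} [Finite M] {G : M → Gadget Sig k (M ⊕ E)} {m : M}
    {t : RTree Sig rank} {x y : GC k t} {e : E} (h : (G m).Run t x (Sum.inr e) y) :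
    (loop G m).Run t x e y :=
  GStep.embed (K := loop G m) (Sum.elim (fun q => Sum.inl ⟨m, q⟩)
      (Sum.elim (fun m' => Sum.inl ⟨m', (G m').entry⟩) Sum.inr))
    (fun q => ⟨⟨m, q⟩, rfl, rfl⟩) h

theorem loop_cont {M E : Type} [Finite M] {G : M → Gadget Sig k (M ⊕ E)} {m m' : M}
    {t : RTree Sig rank} {x y z : GC k t} {e : E} (h : (G m).Run t x (Sum.inl m') y)
    (h' : (loop G m').Run t y e z) :
    (loop G m).Run t x e z := by
  have a1 := GStep.embed (K := loop G m) (Sum.elim (fun q => Sum.inl ⟨m, q⟩)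
      (Sum.elim (fun m' => Sum.inl ⟨m', (G m').entry⟩) Sum.inr))
    (fun q => ⟨⟨m, q⟩, rfl, rfl⟩) h
  have a2 := GStep.embed (G := loop G m') (K := loop G m) id
    (fun q => ⟨q, rfl, by
      show (loop G m').prog q = ((loop G m').prog q).map id
      cases (loop G m').prog q <;> rfl⟩) h'
  exact a1.trans a2

theorem loop_star {M E : Type} [Finite M] {G : M → Gadget Sig k (M ⊕ E)}
    {t : RTree Sig rank} {a b : M × GC k t} {z : GC k t} {e : E}
    (h : Relation.ReflTransGen
      (fun a b : M × GC k t => (G a.1).Run t a.2 (Sum.inl b.1) b.2) a b)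
    (h' : (G b.1).Run t b.2 (Sum.inr e) z) :
    (loop G a.1).Run t a.2 e z := by
  induction h using Relation.ReflTransGen.head_induction_on with
  | refl => exact loop_exit h'
  | head h _ ih => exact loop_cont h ih

/-- Test a list of tests; exit with the first that holds. -/
def switchL [NeZero k] {I : Type} (τ : I → TTest Sig k ℕ) : List I → Gadget Sig k (Option I)
  | [] => pureG none
  | a :: l => (prim (.test (τ a) true false)).bind
      (fun b => if b then pureG (some a) else switchL τ l)

theorem switchL_run [NeZero k] {I : Type} {τ : I → TTest Sig k ℕ} {t : RTree Sig rank}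
    {x : GC k t} {a : I} (ha : ∀ b, THolds t (τ b) x.1 x.2 ↔ b = a) :
    ∀ l : List I, a ∈ l → (switchL τ l).Run t x (some a) x
  | [], h => by simp at h
  | b :: l, h => by
    obtain ⟨hs, π⟩ := x
    by_cases hb : THolds t (τ b) hs π
    · refine bind_run (prim_run (.testT hb)) ?_
      have : b = a := (ha b).1 hb
      subst this
      exact pureG_run
    · refine bind_run (prim_run (.testF hb)) ?_
      have hne : b ≠ a := fun h => hb ((ha b).2 h)
      refine switchL_run ha l ?_
      rcases List.mem_cons.1 h with h | h
      · exact absurd h.symm hne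
      · exact h

end gadgets
end NestedPebbles

namespace NestedPebbles

/-! ### Depth-first tours of finite in-trees -/

def IsFirst {C : Type} [LinearOrder C] (φ : C → C → Prop) (c d : C) : Prop :=
  φ d c ∧ ∀ d', φ d' c → d ≤ d'

def IsNext {C : Type} [LinearOrder C] (φ : C → C → Prop) (c d : C) : Prop :=
  ∃ p, φ c p ∧ φ d p ∧ c < d ∧ ∀ d', φ d' p → c < d' → d ≤ d'

theorem exists_least {C : Type} [Finite C] [LinearOrder C] (p : C → Prop) (h : ∃ c, p c) :
    ∃ c, p c ∧ ∀ d, p d → c ≤ d := by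
  have wf : WellFounded (fun a b : C => a < b) := Finite.wellFounded_of_trans_of_irrefl _
  refine ⟨wf.min {c | p c} h, wf.min_mem _ h, fun d hd => ?_⟩
  exact not_lt.1 (wf.not_lt_min _ hd)

theorem tour {C St : Type} [Finite C] [LinearOrder C] (φ : C → C → Prop)
    (hφ : ∀ a b b', φ a b → φ a b' → b = b') (v : C) (hv : ∀ d, ¬ φ v d)
    (S : C → Prop) (R : St → St → Prop) (D U : C → St)
    (h1 : ∀ c d, ¬ S c → IsFirst φ c d → R (D c) (D d))
    (h2 : ∀ c, ¬ S c → (∀ d, ¬ φ d c) → R (D c) (U c))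
    (h3 : ∀ c d, IsNext φ c d → R (U c) (D d))
    (h4 : ∀ c p, φ c p → (∀ d', φ d' p → ¬ c < d') → R (U c) (U p)) :
    ∀ c, Relation.ReflTransGen φ c v →
      (∃ u, Relation.ReflTransGen φ u c ∧ S u ∧ Relation.ReflTransGen R (D c) (D u)) ∨
      ((∀ u, Relation.ReflTransGen φ u c → ¬ S u) ∧ Relation.ReflTransGen R (D c) (U c)) := by
  have irr : ∀ c, Relation.ReflTransGen φ c v → ¬ Relation.TransGen φ c c := by
    intro c hc
    induction hc using Relation.ReflTransGen.head_induction_on with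
    | refl =>
      intro h
      obtain ⟨d, hd, _⟩ := Relation.TransGen.head'_iff.1 h
      exact hv d hd
    | head hab _ ih =>
      intro h
      obtain ⟨d, hd, hd'⟩ := Relation.TransGen.head'_iff.1 h
      have := hφ _ _ _ hab hd
      subst this
      exact ih (Relation.TransGen.tail' hd' hab)
  let W := {c // Relation.ReflTransGen φ c v}
  have wf : WellFounded (fun a b : W => Relation.TransGen φ a.1 b.1) := by
    have i1 : IsTrans W (fun a b : W => Relation.TransGen φ a.1 b.1) :=
      ⟨fun a b c h h' => h.trans h'⟩
    have i2 : Std.Irrefl (fun a b : W => Relation.TransGen φ a.1 b.1) :=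
      ⟨fun a h => irr a.1 a.2 h⟩
    exact Finite.wellFounded_of_trans_of_irrefl _
  have wg : WellFounded (fun a b : C => b < a) := by
    have i1 : IsTrans C (fun a b : C => b < a) := ⟨fun a b c h h' => h'.trans h⟩
    have i2 : Std.Irrefl (fun a b : C => b < a) := ⟨fun a h => lt_irrefl _ h⟩
    exact Finite.wellFounded_of_trans_of_irrefl _
  suffices H : ∀ c : W, (∃ u, Relation.ReflTransGen φ u c.1 ∧ S u ∧
        Relation.ReflTransGen R (D c.1) (D u)) ∨
      ((∀ u, Relation.ReflTransGen φ u c.1 → ¬ S u) ∧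
        Relation.ReflTransGen R (D c.1) (U c.1)) from fun c hc => H ⟨c, hc⟩
  intro c
  induction c using wf.induction with
  | _ c ih =>
    obtain ⟨c, hc⟩ := c
    simp only at ih ⊢
    by_cases hS : S c
    · exact .inl ⟨c, .refl, hS, .refl⟩
    by_cases hch : ∃ d, φ d c
    · have claim : ∀ d, φ d c →
          (∃ u, Relation.ReflTransGen φ u c ∧ S u ∧ Relation.ReflTransGen R (D d) (D u)) ∨
          ((∀ d' u, φ d' c → d ≤ d' → Relation.ReflTransGen φ u d' → ¬ S u) ∧
            Relation.ReflTransGen R (D d) (U c)) := by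
        intro d
        induction d using wg.induction with
        | _ d ihd =>
          intro hd
          rcases ih ⟨d, .head hd hc⟩ (.single hd) with ⟨u, hu, hSu, hR⟩ | ⟨hn, hR⟩
          · exact .inl ⟨u, hu.tail hd, hSu, hR⟩
          · by_cases hnx : ∃ e, φ e c ∧ d < e
            · obtain ⟨e, ⟨he, hde⟩, hmin⟩ := exists_least _ hnx
              have hst : R (U d) (D e) :=
                h3 _ _ ⟨c, hd, he, hde, fun d' h h' => hmin d' ⟨h, h'⟩⟩
              rcases ihd e hde he with ⟨u, hu, hSu, hR'⟩ | ⟨hn', hR'⟩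
              · exact .inl ⟨u, hu, hSu, (hR.tail hst).trans hR'⟩
              · refine .inr ⟨?_, (hR.tail hst).trans hR'⟩
                intro d' u hd' hle hu
                rcases hle.eq_or_lt with rfl | hlt
                · exact hn u hu
                · exact hn' d' u hd' (hmin d' ⟨hd', hlt⟩) hu
            · refine .inr ⟨?_, hR.tail (h4 d c hd fun d' h h' => hnx ⟨d', h, h'⟩)⟩
              intro d' u hd' hle hu
              rcases hle.eq_or_lt with rfl | hlt
              · exact hn u hu
              · exact absurd ⟨d', hd', hlt⟩ hnx
      obtain ⟨f, hf, hmin⟩ := exists_least _ hch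
      have hst : R (D c) (D f) := h1 c f hS ⟨hf, hmin⟩
      rcases claim f hf with ⟨u, hu, hSu, hR⟩ | ⟨hn, hR⟩
      · exact .inl ⟨u, hu, hSu, .head hst hR⟩
      · refine .inr ⟨?_, .head hst hR⟩
        intro u hu
        rcases Relation.ReflTransGen.cases_tail hu with rfl | ⟨d, hd, hdc⟩
        · exact hS
        · exact hn d u hdc (hmin d hdc) hd
    · refine .inr ⟨?_, .single (h2 c hS fun d hd => hch ⟨d, hd⟩)⟩
      intro u hu
      rcases Relation.ReflTransGen.cases_tail hu with rfl | ⟨d, hd, hdc⟩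
      · exact hS
      · exact absurd ⟨d, hdc⟩ hch

/-! ### Positions -/

section positions
variable {Sig : Type} {rank : Sig → ℕ}

theorem subtree_append (t : RTree Sig rank) (p q : List ℕ) :
    t.subtree (p ++ q) = (t.subtree p).bind fun s => s.subtree q := by
  induction p generalizing t with
  | nil => simp [RTree.subtree]
  | cons i p ih =>
    simp only [List.cons_append, RTree.subtree]
    cases t.child i with
    | none => rfl
    | some s => simp [ih]

theorem labelAt_isSome {t : RTree Sig rank} (p : Pos t) : ∃ a, labelAt t p.1 = some a := by
  obtain ⟨p, hp⟩ := p
  obtain ⟨s, hs⟩ := Option.isSome_iff_exists.1 hp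
  exact ⟨s.label, by simp [labelAt, hs]⟩

theorem isPos_snoc {t : RTree Sig rank} {p : Pos t} {a : Sig} (ha : labelAt t p.1 = some a)
    (j : ℕ) : IsPos t (p.1 ++ [j]) ↔ j < rank a := by
  obtain ⟨p, hp⟩ := p
  obtain ⟨s, hs⟩ := Option.isSome_iff_exists.1 hp
  simp only [labelAt, hs, Option.map_some, Option.some.injEq] at ha
  simp only [IsPos, subtree_append, hs, Option.bind_some, RTree.subtree]
  cases s with
  | node b c =>
    simp only [RTree.label] at ha
    subst ha
    by_cases h : j < rank b <;> simp [RTree.child, h]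

theorem isPos_of_append {t : RTree Sig rank} {p q : List ℕ} (h : IsPos t (p ++ q)) :
    IsPos t p := by
  unfold IsPos at *
  rw [subtree_append] at h
  cases hs : t.subtree p with
  | none => simp [hs] at h
  | some s => rfl

theorem finite_isPos (t : RTree Sig rank) : {p | IsPos t p}.Finite := by
  induction t with
  | node a c ih =>
    refine Set.Finite.subset (s := {[]} ∪ ⋃ i : Fin (rank a), (fun p => i.1 :: p) '' {p | IsPos (c i) p})
      ((Set.finite_singleton _).union (Set.finite_iUnion fun i => (ih i).image _)) ?_
    intro p hp
    cases p with
    | nil => simp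
    | cons i p =>
      right
      simp only [IsPos, Set.mem_ofPred_eq, RTree.subtree, RTree.child] at hp
      by_cases h : i < rank a
      · simp only [h, dif_pos, Option.bind_some] at hp
        exact Set.mem_iUnion.2 ⟨⟨i, h⟩, p, hp, rfl⟩
      · simp [h] at hp

instance (t : RTree Sig rank) : Finite (Pos t) := finite_isPos t

instance (t : RTree Sig rank) : LinearOrder (Pos t) :=
  LinearOrder.lift' (fun p : Pos t => p.1) (fun _ _ h => Subtype.ext h)

theorem Pos.lt_def {t : RTree Sig rank} {p q : Pos t} : p < q ↔ p.1 < q.1 := Iff.rfl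

theorem childNo_snoc (p : List ℕ) (j : ℕ) : childNo (p ++ [j]) = j + 1 := by
  simp [childNo]

theorem childNo_eq_zero {p : List ℕ} : childNo p = 0 ↔ p = [] := by
  rcases List.eq_nil_or_concat p with rfl | ⟨q, j, rfl⟩
  · simp [childNo]
  · simp [childNo]

theorem childNo_pos {p : List ℕ} {j : ℕ} (h : childNo p = j + 1) : ∃ q, p = q ++ [j] := by
  rcases List.eq_nil_or_concat p with rfl | ⟨q, j', rfl⟩
  · simp [childNo] at h
  · simp [childNo] at h
    exact ⟨q, by simp [h]⟩

/-- Bound on the ranks. -/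
noncomputable def maxRank [Fintype Sig] (rank : Sig → ℕ) : ℕ := Finset.univ.sup rank

theorem childNo_le [Fintype Sig] {t : RTree Sig rank} (p : Pos t) :
    childNo p.1 ≤ maxRank rank := by
  obtain ⟨p, hp⟩ := p
  rcases List.eq_nil_or_concat p with rfl | ⟨q, j, rfl⟩
  · simp [childNo]
  · simp only [List.concat_eq_append] at hp
    obtain ⟨a, ha⟩ := labelAt_isSome (⟨q, isPos_of_append hp⟩ : Pos t)
    have := (isPos_snoc ha j).1 hp
    have h2 : rank a ≤ maxRank rank := Finset.le_sup (Finset.mem_univ a)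
    simp only [List.concat_eq_append, childNo_snoc]
    omega

theorem snoc_lt_snoc {p : List ℕ} {i j : ℕ} : p ++ [i] < p ++ [j] ↔ i < j := by
  induction p with
  | nil => simp [List.cons_lt_cons_iff]
  | cons a p ih => simp [ih]

theorem pos_lt_snoc {t : RTree Sig rank} {c d p : Pos t} {i j : ℕ} (hc : c.1 = p.1 ++ [i])
    (hd : d.1 = p.1 ++ [j]) : c < d ↔ i < j := by
  rw [Pos.lt_def, hc, hd, snoc_lt_snoc]

/-- Child relation: `IsChild d c` if `d` is a child of `c`. -/
def IsChild {t : RTree Sig rank} (d c : Pos t) : Prop := ∃ j, d.1 = c.1 ++ [j]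

theorem IsChild.unique {t : RTree Sig rank} {d c c' : Pos t} (h : IsChild d c)
    (h' : IsChild d c') : c = c' := by
  obtain ⟨j, h⟩ := h
  obtain ⟨j', h'⟩ := h'
  rw [h] at h'
  exact Subtype.ext (List.append_inj' h' rfl).1

theorem not_isChild_root {t : RTree Sig rank} (c : Pos t) : ¬ IsChild (rootPos t) c := by
  rintro ⟨j, h⟩
  simp [rootPos] at h

theorem reaches_of_prefix {t : RTree Sig rank} (p : Pos t) : ∀ (l : List ℕ) (q : Pos t),
    q.1 = p.1 ++ l → Relation.ReflTransGen IsChild q p := by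
  intro l
  induction l using List.reverseRecOn with
  | nil =>
    intro q h
    have : q = p := Subtype.ext (by simpa using h)
    subst this
    exact .refl
  | append_singleton l j ih =>
    intro q h
    have hp : IsPos t (p.1 ++ l) := by
      have := q.2
      rw [h, ← List.append_assoc] at this
      exact isPos_of_append this
    exact .head (b := ⟨p.1 ++ l, hp⟩) ⟨j, by simp [h]⟩ (ih ⟨_, hp⟩ rfl)

theorem reaches_root {t : RTree Sig rank} (p : Pos t) :
    Relation.ReflTransGen IsChild p (rootPos t) :=
  reaches_of_prefix _ p.1 p (by simp [rootPos])

end positions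
end NestedPebbles

namespace NestedPebbles
section search
set_option linter.unusedSectionVars false
variable {Sig : Type} [Fintype Sig] {rank : Sig → ℕ} {k : ℕ} [NeZero k]

noncomputable def hasChild (rank : Sig → ℕ) (i : Fin k) (j : ℕ) : Gadget Sig k Bool :=
  (switchL (fun a => .lab i a) (Finset.univ : Finset Sig).toList).bind fun o =>
    match o with
    | some a => pureG (decide (j < rank a))
    | none => pureG false

theorem hasChild_run {t : RTree Sig rank} (i : Fin k) (j : ℕ) (x : GC k t) :
    ∃ b, (b = true ↔ IsPos t ((x.1 i).1 ++ [j])) ∧ (hasChild rank i j).Run t x b x := by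
  obtain ⟨a, ha⟩ := labelAt_isSome (x.1 i)
  refine ⟨decide (j < rank a), by simp [isPos_snoc ha], ?_⟩
  refine bind_run (switchL_run (a := a) ?_ _ (by simp)) pureG_run
  intro b
  simp [THolds, ha, eq_comm]

noncomputable def getChno (rank : Sig → ℕ) (i : Fin k) :
    Gadget Sig k (Option (Fin (maxRank rank + 1))) :=
  switchL (fun j => .chno i j.1) Finset.univ.toList

theorem getChno_run {t : RTree Sig rank} (i : Fin k) (x : GC k t) :
    (getChno rank i).Run t x
      (some ⟨childNo (x.1 i).1, Nat.lt_succ_of_le (childNo_le _)⟩) x := by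
  refine switchL_run ?_ _ (by simp)
  intro b
  simp [THolds, Fin.ext_iff, eq_comm]

noncomputable def searchBody (rank : Sig → ℕ) (i : Fin k) (T : Gadget Sig k Bool) :
    Bool → Gadget Sig k (Bool ⊕ Bool)
  | true => T.bind fun b =>
      match b with
      | true => pureG (Sum.inr true)
      | false => (hasChild rank i 0).bind fun b =>
          match b with
          | true => prim (.down i 1 (Sum.inl true))
          | false => pureG (Sum.inl false)
  | false => (getChno rank i).bind fun o =>
      match o with
      | none => pureG (Sum.inr false)
      | some ⟨0, _⟩ => pureG (Sum.inr false)
      | some ⟨j + 1, _⟩ => (prim (.up i ())).bind fun _ => (hasChild rank i (j + 1)).bind fun b =>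
          match b with
          | true => prim (.down i (j + 2) (Sum.inl true))
          | false => pureG (Sum.inl false)

/-- Search the tree with head `i` for a node accepted by `T`. -/
noncomputable def search (rank : Sig → ℕ) (i : Fin k) (T : Gadget Sig k Bool) :
    Gadget Sig k Bool := loop (searchBody rank i T) true

theorem upPart_run {t : RTree Sig rank} {i : Fin k} {T : Gadget Sig k Bool} {hs : Fin k → Pos t}
    {π : List (Pos t)} {c p : Pos t} {j : ℕ} {e : Bool ⊕ Bool} {y : GC k t}
    (hj : c.1 = p.1 ++ [j])
    (h : ((hasChild rank i (j + 1)).bind fun b =>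
          match b with
          | true => (prim (.down i (j + 2) (Sum.inl true)) : Gadget Sig k (Bool ⊕ Bool))
          | false => pureG (Sum.inl false)).Run t (Function.update hs i p, π) e y) :
    (searchBody rank i T false).Run t (Function.update hs i c, π) e y := by
  have hc : childNo c.1 = j + 1 := by rw [hj, childNo_snoc]
  refine bind_run (getChno_run i _) ?_
  simp only [Function.update_self, hc]
  refine bind_run (prim_run (CStep.up (p := p) (j := j) (by simp [hj]))) ?_
  simpa using h

theorem search_run {t : RTree Sig rank} {i : Fin k} {T : Gadget Sig k Bool} {hs : Fin k → Pos t}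
    {π : List (Pos t)} {S : Pos t → Prop}
    (hT : ∀ u, ∃ b, (b = true ↔ S u) ∧
      T.Run t (Function.update hs i u, π) b (Function.update hs i u, π)) :
    (∃ u, S u ∧ (search rank i T).Run t (Function.update hs i (rootPos t), π) true
      (Function.update hs i u, π)) ∨
    ((∀ u, ¬ S u) ∧ (search rank i T).Run t (Function.update hs i (rootPos t), π) false
      (Function.update hs i (rootPos t), π)) := by
  have hTt : ∀ u, S u → T.Run t (Function.update hs i u, π) true (Function.update hs i u, π) := by
    intro u hu
    obtain ⟨b, hb, h⟩ := hT u
    rwa [hb.2 hu] at h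
  have hTf : ∀ u, ¬ S u →
      T.Run t (Function.update hs i u, π) false (Function.update hs i u, π) := by
    intro u hu
    obtain ⟨b, hb, h⟩ := hT u
    cases b
    · exact h
    · exact absurd (hb.1 rfl) hu
  have key := tour (C := Pos t) (St := Bool × GC k t) IsChild (fun a b b' => IsChild.unique)
    (rootPos t) not_isChild_root S
    (fun a b => (searchBody rank i T a.1).Run t a.2 (Sum.inl b.1) b.2)
    (fun u => (true, (Function.update hs i u, π))) (fun u => (false, (Function.update hs i u, π)))
    ?_ ?_ ?_ ?_ (rootPos t) .refl
  · rcases key with ⟨u, _, hu, h⟩ | ⟨hn, h⟩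
    · exact .inl ⟨u, hu, loop_star h (bind_run (hTt u hu) pureG_run)⟩
    · refine .inr ⟨fun u => hn u (reaches_root u), loop_star h ?_⟩
      refine bind_run (getChno_run i _) ?_
      simp only [Function.update_self]
      exact pureG_run
  · rintro c d hS ⟨⟨j, hj⟩, hmin⟩
    have hj0 : j = 0 := by
      obtain ⟨a, ha⟩ := labelAt_isSome c
      have h1 : j < rank a := (isPos_snoc ha j).1 (hj ▸ d.2)
      have h2 := hmin ⟨c.1 ++ [0], (isPos_snoc ha 0).2 (by omega)⟩ ⟨0, rfl⟩
      by_contra hne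
      refine absurd h2 (not_le.2 ?_)
      exact (pos_lt_snoc rfl hj).2 (Nat.pos_of_ne_zero hne)
    subst hj0
    refine bind_run (hTf c hS) ?_
    obtain ⟨b, hb, hrun⟩ := hasChild_run (rank := rank) i 0 (Function.update hs i c, π)
    have : b = true := hb.2 (by simpa [← hj] using d.2)
    subst this
    refine bind_run hrun ?_
    have := CStep.down (t := t) (i := i) (j := 1) (a := (Sum.inl true : Bool ⊕ Bool))
      (hs := Function.update hs i c) (π := π) (p := d) le_rfl (by simp [hj])
    simpa using prim_run this
  · intro c hS hn
    refine bind_run (hTf c hS) ?_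
    obtain ⟨b, hb, hrun⟩ := hasChild_run (rank := rank) i 0 (Function.update hs i c, π)
    have : b = false := by
      by_contra hne
      have := hb.1 (by simpa using hne)
      simp only [Function.update_self] at this
      exact hn ⟨_, this⟩ ⟨0, rfl⟩
    subst this
    exact bind_run hrun pureG_run
  · rintro c d ⟨p, ⟨j, hj⟩, ⟨j', hj'⟩, hlt, hmin⟩
    refine upPart_run hj ?_
    have hjj : j < j' := (pos_lt_snoc hj hj').1 hlt
    obtain ⟨a, ha⟩ := labelAt_isSome p
    have h1 : j' < rank a := (isPos_snoc ha j').1 (hj' ▸ d.2)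
    have hp : IsPos t (p.1 ++ [j + 1]) := (isPos_snoc ha _).2 (by omega)
    have hj1 : j' = j + 1 := by
      have h2 := hmin ⟨p.1 ++ [j + 1], hp⟩ ⟨_, rfl⟩ ((pos_lt_snoc hj rfl).2 (by omega))
      by_contra hne
      refine absurd h2 (not_le.2 ?_)
      exact (pos_lt_snoc rfl hj').2 (by omega)
    subst hj1
    obtain ⟨b, hb, hrun⟩ := hasChild_run (rank := rank) i (j + 1) (Function.update hs i p, π)
    have : b = true := hb.2 (by simpa using hp)
    subst this
    refine bind_run hrun ?_
    have := CStep.down (t := t) (i := i) (j := j + 2) (a := (Sum.inl true : Bool ⊕ Bool))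
      (hs := Function.update hs i p) (π := π) (p := d) (by omega) (by simp [hj'])
    simpa using prim_run this
  · rintro c p ⟨j, hj⟩ hn
    refine upPart_run hj ?_
    obtain ⟨b, hb, hrun⟩ := hasChild_run (rank := rank) i (j + 1) (Function.update hs i p, π)
    have : b = false := by
      by_contra hne
      have := hb.1 (by simpa using hne)
      simp only [Function.update_self] at this
      exact hn ⟨_, this⟩ ⟨_, rfl⟩ ((pos_lt_snoc hj rfl).2 (by simp))
    subst this
    exact bind_run hrun pureG_run

/-- Move head `i` to the root. -/
def reset (i : Fin k) : Gadget Sig k Unit :=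
  loop (M := Unit) (fun _ => (prim (.test (.chno i 0) true false)).bind fun b =>
    match b with
    | true => pureG (Sum.inr ())
    | false => prim (.up i (Sum.inl ()))) ()

theorem reset_run {t : RTree Sig rank} (i : Fin k) (hs : Fin k → Pos t) (π : List (Pos t)) :
    (reset i : Gadget Sig k Unit).Run t (hs, π) () (Function.update hs i (rootPos t), π) := by
  have main : ∀ (u : Pos t), Relation.ReflTransGen IsChild u (rootPos t) →
      (reset i : Gadget Sig k Unit).Run t (Function.update hs i u, π) ()
        (Function.update hs i (rootPos t), π) := by
    intro u hu
    induction hu using Relation.ReflTransGen.head_induction_on with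
    | refl =>
      refine loop_exit (bind_run (prim_run (.testT ?_)) pureG_run)
      simp only [THolds, Function.update_self]
      rfl
    | @head a c h _ ih =>
      obtain ⟨j, hj⟩ := h
      refine loop_cont (m' := ()) (bind_run (prim_run (.testF ?_))
        (prim_run (CStep.up (p := c) (j := j) ?_))) 
        (by rw [Function.update_idem]; exact ih)
      · simp [THolds, hj, childNo_snoc]
      · simp [hj]
  simpa using main (hs i) (reaches_root _)

/-- Move head `i` to pebble `x`. -/
noncomputable def place (rank : Sig → ℕ) (i : Fin k) (x : ℕ) : Gadget Sig k Unit :=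
  (reset i).bind fun _ => (search rank i (prim (.test (.peb i x) true false))).bind
    fun _ => pureG ()

theorem place_run {t : RTree Sig rank} (i : Fin k) {x : ℕ} {hs : Fin k → Pos t}
    {π : List (Pos t)} {u : Pos t} (hx : π[x]? = some u) :
    (place rank i x).Run t (hs, π) () (Function.update hs i u, π) := by
  refine bind_run (reset_run i hs π) ?_
  have hT : ∀ w, ∃ b, (b = true ↔ π[x]? = some w) ∧
      (prim (.test (.peb i x) true false) : Gadget Sig k Bool).Run t
        (Function.update hs i w, π) b (Function.update hs i w, π) := by
    intro w
    by_cases h : π[x]? = some w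
    · exact ⟨true, by simp [h], prim_run (.testT (by simp [THolds, h]))⟩
    · exact ⟨false, by simp [h], prim_run (.testF (by simpa [THolds] using h))⟩
  rcases search_run hT with ⟨w, hw, h⟩ | ⟨hn, _⟩
  · have : w = u := by simpa [hx, eq_comm] using hw
    subst this
    exact bind_run h pureG_run
  · exact absurd hx (hn u)

end search
end NestedPebbles

namespace NestedPebbles
section testable
set_option linter.unusedSectionVars false
variable {Sig : Type} [Fintype Sig] {rank : Sig → ℕ} {k : ℕ} [NeZero k]

def rootH (k : ℕ) (t : RTree Sig rank) : Fin k → Pos t := fun _ => rootPos t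

theorem update_rootH (t : RTree Sig rank) (i : Fin k) :
    Function.update (rootH k t) i (rootPos t) = rootH k t := by
  funext j
  by_cases h : j = i
  · subst h; simp [rootH]
  · simp [h]

/-- A predicate on tuples of nodes is testable if there is an always halting gadget that
decides it when the arguments are stored by pebbles. -/
def Testable (k : ℕ) {V : Type} (P : ∀ t : RTree Sig rank, (V → Pos t) → Prop) : Prop :=
  ∀ (m : ℕ) (idx : V → ℕ), ∃ G : Gadget Sig k Bool, ∀ (t : RTree Sig rank) (π : List (Pos t))
    (ν : V → Pos t), π.length = m → (∀ v, π[idx v]? = some (ν v)) →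
    ∃ b, (b = true ↔ P t ν) ∧ G.Run t (rootH k t, π) b (rootH k t, π)

def Findable (k : ℕ) {V : Type} {n : ℕ}
    (P : ∀ t : RTree Sig rank, (V → Pos t) → (Fin n → Pos t) → Prop) : Prop :=
  ∀ (m : ℕ) (idx : V → ℕ), ∃ G : Gadget Sig k Bool, ∀ (t : RTree Sig rank) (π : List (Pos t))
    (ν : V → Pos t), π.length = m → (∀ v, π[idx v]? = some (ν v)) →
    (∃ us, P t ν us ∧ G.Run t (rootH k t, π) true (rootH k t, π ++ List.ofFn us)) ∨
    ((∀ us, ¬ P t ν us) ∧ G.Run t (rootH k t, π) false (rootH k t, π))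

variable {V V' : Type}

theorem Testable.congr {P P' : ∀ t : RTree Sig rank, (V → Pos t) → Prop} (h : Testable k P)
    (hPP : ∀ t ν, P t ν ↔ P' t ν) : Testable k P' := by
  have : P = P' := by
    funext t ν
    exact propext (hPP t ν)
  exact this ▸ h

theorem Testable.rename {P : ∀ t : RTree Sig rank, (V → Pos t) → Prop} (h : Testable k P)
    (f : V → V') : Testable k (fun (t : RTree Sig rank) (ν : V' → Pos t) => P t (ν ∘ f)) := by
  intro m idx
  obtain ⟨G, hG⟩ := h m (idx ∘ f)
  exact ⟨G, fun t π ν hm hν => hG t π (ν ∘ f) hm fun v => hν (f v)⟩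

theorem Testable.const (p : Prop) :
    Testable k (fun (t : RTree Sig rank) (_ : V → Pos t) => p) := by
  intro m idx
  by_cases hp : p
  · exact ⟨pureG true, fun t π ν _ _ => ⟨true, by simp [hp], pureG_run⟩⟩
  · exact ⟨pureG false, fun t π ν _ _ => ⟨false, by simp [hp], pureG_run⟩⟩

theorem Testable.not {P : ∀ t : RTree Sig rank, (V → Pos t) → Prop} (h : Testable k P) :
    Testable k (fun (t : RTree Sig rank) ν => ¬ P t ν) := by
  intro m idx
  obtain ⟨G, hG⟩ := h m idx
  refine ⟨G.bind fun b => pureG (!b), fun t π ν hm hν => ?_⟩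
  obtain ⟨b, hb, hr⟩ := hG t π ν hm hν
  exact ⟨!b, by cases b <;> simp_all, bind_run hr pureG_run⟩

theorem Testable.and {P P' : ∀ t : RTree Sig rank, (V → Pos t) → Prop} (h : Testable k P)
    (h' : Testable k P') : Testable k (fun (t : RTree Sig rank) ν => P t ν ∧ P' t ν) := by
  intro m idx
  obtain ⟨G, hG⟩ := h m idx
  obtain ⟨G', hG'⟩ := h' m idx
  refine ⟨G.bind fun b => G'.bind fun b' => pureG (b && b'), fun t π ν hm hν => ?_⟩
  obtain ⟨b, hb, hr⟩ := hG t π ν hm hν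
  obtain ⟨b', hb', hr'⟩ := hG' t π ν hm hν
  exact ⟨b && b', by simp [← hb, ← hb'], bind_run hr (bind_run hr' pureG_run)⟩

theorem Testable.or {P P' : ∀ t : RTree Sig rank, (V → Pos t) → Prop} (h : Testable k P)
    (h' : Testable k P') : Testable k (fun (t : RTree Sig rank) ν => P t ν ∨ P' t ν) :=
  (h.not.and h'.not).not.congr fun t ν => by tauto

theorem Testable.imp {P P' : ∀ t : RTree Sig rank, (V → Pos t) → Prop} (h : Testable k P)
    (h' : Testable k P') : Testable k (fun (t : RTree Sig rank) ν => P t ν → P' t ν) :=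
  (h.and h'.not).not.congr fun t ν => by tauto

theorem Testable.iff_const {P : ∀ t : RTree Sig rank, (V → Pos t) → Prop} (h : Testable k P)
    (p : Prop) : Testable k (fun (t : RTree Sig rank) ν => P t ν ↔ p) := by
  by_cases hp : p
  · exact h.congr fun t ν => by simp [hp]
  · exact h.not.congr fun t ν => by simp [hp]

theorem Testable.exFin {ι : Type} [Finite ι] {P : ι → ∀ t : RTree Sig rank, (V → Pos t) → Prop}
    (h : ∀ i, Testable k (P i)) :
    Testable k (fun (t : RTree Sig rank) ν => ∃ i, P i t ν) := by
  have := Fintype.ofFinite ι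
  have key : ∀ l : List ι, Testable k (fun (t : RTree Sig rank) ν => ∃ i ∈ l, P i t ν) := by
    intro l
    induction l with
    | nil => exact (Testable.const False).congr fun t ν => by simp
    | cons i l ih => exact ((h i).or ih).congr fun t ν => by simp
  exact (key Finset.univ.toList).congr fun t ν => by simp

theorem Testable.allFin {ι : Type} [Finite ι] {P : ι → ∀ t : RTree Sig rank, (V → Pos t) → Prop}
    (h : ∀ i, Testable k (P i)) :
    Testable k (fun (t : RTree Sig rank) ν => ∀ i, P i t ν) :=
  (Testable.exFin fun i => (h i).not).not.congr fun t ν => by simp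

theorem getElem?_append_of_some {α : Type} {π l : List α} {x : ℕ} {u : α}
    (h : π[x]? = some u) : (π ++ l)[x]? = some u := by
  obtain ⟨hx, _⟩ := List.getElem?_eq_some_iff.1 h
  rw [List.getElem?_append_left hx, h]

/-- Finding a single node. -/
theorem find_one {P : ∀ t : RTree Sig rank, (V → Pos t) → Pos t → Prop}
    (h : Testable k (fun (t : RTree Sig rank) (ν : Option V → Pos t) =>
      P t (fun v => ν (some v)) (ν none))) (m : ℕ) (idx : V → ℕ) :
    ∃ G : Gadget Sig k Bool, ∀ (t : RTree Sig rank) (π : List (Pos t))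
    (ν : V → Pos t), π.length = m → (∀ v, π[idx v]? = some (ν v)) →
    (∃ u, P t ν u ∧ G.Run t (rootH k t, π) true (rootH k t, π ++ [u])) ∨
    ((∀ u, ¬ P t ν u) ∧ G.Run t (rootH k t, π) false (rootH k t, π)) := by
  obtain ⟨G, hG⟩ := h (m + 1) (fun o => o.elim m idx)
  let T : Gadget Sig k Bool := (prim (.drop 0 m ())).bind fun _ => (reset 0).bind fun _ =>
    G.bind fun b => (place rank 0 m).bind fun _ => prim (.retr m b)
  refine ⟨(search rank 0 T).bind fun b =>
    match b with
    | false => pureG false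
    | true => (prim (.drop 0 m ())).bind fun _ => (reset 0).bind fun _ => pureG true, ?_⟩
  intro t π ν hm hν
  have hT : ∀ u, ∃ b, (b = true ↔ P t ν u) ∧
      T.Run t (Function.update (rootH k t) 0 u, π) b (Function.update (rootH k t) 0 u, π) := by
    intro u
    obtain ⟨b, hb, hr⟩ := hG t (π ++ [u]) (fun o => o.elim u ν) (by simp [hm]) (by
      rintro (_ | v)
      · simp [← hm]
      · exact getElem?_append_of_some (hν v))
    refine ⟨b, hb, ?_⟩
    refine bind_run (prim_run (.drop hm)) ?_
    refine bind_run (reset_run _ _ _) ?_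
    simp only [Function.update_self, Function.update_idem, update_rootH]
    refine bind_run hr ?_
    refine bind_run (place_run (u := u) _ (by simp [← hm])) ?_
    exact prim_run (.retr hm)
  rcases search_run hT with ⟨u, hu, hr⟩ | ⟨hn, hr⟩
  · refine .inl ⟨u, hu, ?_⟩
    rw [update_rootH] at hr
    refine bind_run hr ?_
    refine bind_run (prim_run (.drop hm)) ?_
    refine bind_run (reset_run _ _ _) ?_
    simp only [Function.update_self, Function.update_idem, update_rootH]
    exact pureG_run
  · rw [update_rootH] at hr
    exact .inr ⟨hn, bind_run hr pureG_run⟩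

def popN (m : ℕ) : ℕ → Gadget Sig k Unit
  | 0 => pureG ()
  | n + 1 => (prim (.retr (m + n) ())).bind fun _ => popN m n

theorem popN_run {t : RTree Sig rank} {hs : Fin k → Pos t} {m : ℕ} {π : List (Pos t)}
    (hm : π.length = m) : ∀ (n : ℕ) (l : List (Pos t)), l.length = n →
      (popN m n : Gadget Sig k Unit).Run t (hs, π ++ l) () (hs, π)
  | 0, l, h => by
    have : l = [] := List.length_eq_zero_iff.1 h
    subst this
    rw [List.append_nil]
    exact pureG_run
  | n + 1, l, h => by
    rcases List.eq_nil_or_concat l with rfl | ⟨l, u, rfl⟩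
    · simp at h
    · have hl : l.length = n := by simpa using h
      refine bind_run (e := ()) (prim_run ?_) (popN_run hm n l hl)
      rw [List.concat_eq_append, ← List.append_assoc]
      exact .retr (by simp [hm, hl])

theorem Findable.ex {n : ℕ} {P : ∀ t : RTree Sig rank, (V → Pos t) → (Fin n → Pos t) → Prop}
    (h : Findable k P) : Testable k (fun (t : RTree Sig rank) ν => ∃ us, P t ν us) := by
  intro m idx
  obtain ⟨G, hG⟩ := h m idx
  refine ⟨G.bind fun b =>
    match b with
    | false => pureG false
    | true => (popN m n).bind fun _ => pureG true, fun t π ν hm hν => ?_⟩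
  rcases hG t π ν hm hν with ⟨us, hu, hr⟩ | ⟨hn, hr⟩
  · exact ⟨true, by simpa using ⟨us, hu⟩,
      bind_run hr (bind_run (popN_run hm n _ (by simp)) pureG_run)⟩
  · exact ⟨false, by simpa using hn, bind_run hr pureG_run⟩

theorem Testable.findable : ∀ {n : ℕ} {V : Type}
    {P : ∀ t : RTree Sig rank, (V → Pos t) → (Fin n → Pos t) → Prop},
    Testable k (fun (t : RTree Sig rank) (ν : V ⊕ Fin n → Pos t) =>
      P t (fun v => ν (Sum.inl v)) (fun i => ν (Sum.inr i))) → Findable k P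
  | 0, V, P, h => by
    intro m idx
    obtain ⟨G, hG⟩ := h m (Sum.elim idx Fin.elim0)
    refine ⟨G, fun t π ν hm hν => ?_⟩
    obtain ⟨b, hb, hr⟩ := hG t π (Sum.elim ν Fin.elim0) hm (by
      rintro (v | i)
      · exact hν v
      · exact i.elim0)
    have hz : ∀ us : Fin 0 → Pos t, us = fun i => Sum.elim ν Fin.elim0 (Sum.inr i) :=
      fun us => Subsingleton.elim _ _
    cases b
    · right
      refine ⟨fun us hu => ?_, hr⟩
      rw [hz us] at hu
      exact absurd (hb.2 hu) (by simp)
    · left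
      exact ⟨_, hb.1 rfl, by simpa using hr⟩
  | n + 1, V, P, h => by
    have h1 : Findable k (V := Option V) (n := n) (fun (t : RTree Sig rank) ν us =>
        P t (fun v => ν (some v)) (Fin.cons (ν none) us)) := by
      apply Testable.findable
      refine (h.rename (V' := Option V ⊕ Fin n) (Sum.elim (fun v => Sum.inl (some v))
        (Fin.cons (Sum.inl none) (fun i => Sum.inr i)))).congr fun t ν => ?_
      have : (fun i => (ν ∘ Sum.elim (fun v => Sum.inl (some v))
          (Fin.cons (Sum.inl none) (fun i => Sum.inr i))) (Sum.inr i)) =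
          (Fin.cons (ν (Sum.inl none)) (fun i => ν (Sum.inr i)) : Fin (n + 1) → Pos t) := by
        funext i
        refine Fin.cases ?_ (fun j => ?_) i <;> simp
      rw [this]
      rfl
    intro m idx
    obtain ⟨G1, hG1⟩ := find_one (k := k) (V := V) (P := fun (t : RTree Sig rank) ν u =>
      ∃ us : Fin n → Pos t, P t ν (Fin.cons u us)) h1.ex m idx
    obtain ⟨G2, hG2⟩ := h1 (m + 1) (fun o => o.elim m idx)
    refine ⟨G1.bind fun b =>
      match b with
      | false => pureG false
      | true => G2, fun t π ν hm hν => ?_⟩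
    rcases hG1 t π ν hm hν with ⟨u, ⟨us, hu⟩, hr⟩ | ⟨hn, hr⟩
    · left
      rcases hG2 t (π ++ [u]) (fun o => o.elim u ν) (by simp [hm]) (by
        rintro (_ | v)
        · simp [← hm]
        · exact getElem?_append_of_some (hν v)) with ⟨us', hu', hr'⟩ | ⟨hn', _⟩
      · refine ⟨Fin.cons u us', hu', ?_⟩
        have : π ++ List.ofFn (Fin.cons u us' : Fin (n + 1) → Pos t) =
            (π ++ [u]) ++ List.ofFn us' := by
          simp [List.ofFn_succ]
        rw [this]
        exact bind_run hr hr'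
      · exact absurd hu (hn' us)
    · right
      refine ⟨fun us hu => hn (us 0) ⟨Fin.tail us, ?_⟩, bind_run hr pureG_run⟩
      rwa [Fin.cons_self_tail]

theorem Testable.exT {n : ℕ} {P : ∀ t : RTree Sig rank, (V → Pos t) → (Fin n → Pos t) → Prop}
    (h : Testable k (fun (t : RTree Sig rank) (ν : V ⊕ Fin n → Pos t) =>
      P t (fun v => ν (Sum.inl v)) (fun i => ν (Sum.inr i)))) :
    Testable k (fun (t : RTree Sig rank) ν => ∃ us, P t ν us) :=
  h.findable.ex

theorem Testable.exPos {P : ∀ t : RTree Sig rank, (V → Pos t) → Pos t → Prop}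
    (h : Testable k (fun (t : RTree Sig rank) (ν : Option V → Pos t) =>
      P t (fun v => ν (some v)) (ν none))) :
    Testable k (fun (t : RTree Sig rank) ν => ∃ u, P t ν u) := by
  refine (Testable.exT (n := 1) (P := fun (t : RTree Sig rank) (ν : V → Pos t) us => P t ν (us 0))
    (h.rename (V' := V ⊕ Fin 1) (fun o => o.elim (Sum.inr 0) Sum.inl))).congr fun t ν => ?_
  exact ⟨fun ⟨us, h⟩ => ⟨_, h⟩, fun ⟨u, h⟩ => ⟨fun _ => u, h⟩⟩

/-! #### Atomic predicates -/

theorem Testable.atom {P : ∀ t : RTree Sig rank, (V → Pos t) → Prop} (v : V)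
    (H : (V → ℕ) → Gadget Sig k Bool)
    (hH : ∀ (idx : V → ℕ) (t : RTree Sig rank) (π : List (Pos t)) (ν : V → Pos t),
      (∀ v, π[idx v]? = some (ν v)) → ∃ b w, (b = true ↔ P t ν) ∧
        (H idx).Run t (Function.update (rootH k t) 0 (ν v), π) b
          (Function.update (rootH k t) 0 w, π)) :
    Testable k P := by
  intro m idx
  refine ⟨(place rank 0 (idx v)).bind fun _ => (H idx).bind fun b => (reset 0).bind fun _ =>
    pureG b, fun t π ν hm hν => ?_⟩
  obtain ⟨b, w, hb, hr⟩ := hH idx t π ν hν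
  refine ⟨b, hb, bind_run (place_run _ (hν v)) (bind_run hr (bind_run (reset_run _ _ _) ?_))⟩
  simp only [Function.update_idem, update_rootH]
  exact pureG_run

theorem test_run {t : RTree Sig rank} {τ : TTest Sig k ℕ} {hs : Fin k → Pos t}
    {π : List (Pos t)} {P : Prop} (h : THolds t τ hs π ↔ P) :
    ∃ b, (b = true ↔ P) ∧ (prim (.test τ true false)).Run t (hs, π) b (hs, π) := by
  by_cases hp : THolds t τ hs π
  · exact ⟨true, by simp [← h, hp], prim_run (.testT hp)⟩
  · exact ⟨false, by simp [← h, hp], prim_run (.testF hp)⟩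

theorem Testable.lab (a : Sig) (v : V) :
    Testable k (fun (t : RTree Sig rank) (ν : V → Pos t) => labelAt t (ν v).1 = some a) := by
  refine .atom v (fun _ => prim (.test (.lab 0 a) true false)) fun idx t π ν hν => ?_
  obtain ⟨b, hb, hr⟩ := test_run (t := t) (τ := .lab 0 a)
    (hs := Function.update (rootH k t) 0 (ν v)) (π := π)
    (P := labelAt t (ν v).1 = some a) (by simp [THolds])
  exact ⟨b, _, hb, hr⟩

theorem Testable.chno (j : ℕ) (v : V) :
    Testable k (fun (t : RTree Sig rank) (ν : V → Pos t) => childNo (ν v).1 = j) := by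
  refine .atom v (fun _ => prim (.test (.chno 0 j) true false)) fun idx t π ν hν => ?_
  obtain ⟨b, hb, hr⟩ := test_run (t := t) (τ := .chno 0 j)
    (hs := Function.update (rootH k t) 0 (ν v)) (π := π)
    (P := childNo (ν v).1 = j) (by simp [THolds])
  exact ⟨b, _, hb, hr⟩

theorem Testable.eq (v w : V) :
    Testable k (fun (t : RTree Sig rank) (ν : V → Pos t) => ν v = ν w) := by
  refine .atom v (fun idx => prim (.test (.peb 0 (idx w)) true false)) fun idx t π ν hν => ?_
  obtain ⟨b, hb, hr⟩ := test_run (t := t) (τ := .peb 0 (idx w))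
    (hs := Function.update (rootH k t) 0 (ν v)) (π := π)
    (P := ν v = ν w) (by simp [THolds, hν, eq_comm])
  exact ⟨b, _, hb, hr⟩

theorem Testable.isChild (v w : V) :
    Testable k (fun (t : RTree Sig rank) (ν : V → Pos t) => IsChild (ν v) (ν w)) := by
  refine .atom v (fun idx => (prim (.test (.chno 0 0) true false)).bind fun b =>
    match b with
    | true => pureG false
    | false => (prim (.up 0 ())).bind fun _ => prim (.test (.peb 0 (idx w)) true false))
    fun idx t π ν hν => ?_
  by_cases h0 : childNo (ν v).1 = 0
  · refine ⟨false, ν v, ?_, bind_run (prim_run (.testT ?_)) pureG_run⟩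
    · have : ν v = rootPos t := Subtype.ext (childNo_eq_zero.1 h0)
      simp [this, not_isChild_root]
    · simp [THolds, h0]
  · obtain ⟨j, hj⟩ := Nat.exists_eq_succ_of_ne_zero h0
    obtain ⟨q, hq⟩ := childNo_pos hj
    have hpos : IsPos t q := isPos_of_append (q := [j]) (hq ▸ (ν v).2)
    obtain ⟨p, hp⟩ : ∃ p : Pos t, (ν v).1 = p.1 ++ [j] := ⟨⟨q, hpos⟩, hq⟩
    obtain ⟨b, hb, hr⟩ := test_run (t := t) (τ := .peb 0 (idx w))
      (hs := Function.update (rootH k t) 0 p) (π := π)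
      (P := IsChild (ν v) (ν w)) (by
        simp only [THolds, hν, Function.update_self, Option.some.injEq]
        constructor
        · intro h
          exact ⟨j, by rw [h]; exact hp⟩
        · intro h
          exact h.unique ⟨j, hp⟩)
    refine ⟨b, p, hb, bind_run (prim_run (.testF ?_))
      (bind_run (prim_run (CStep.up (p := p) (j := j) ?_)) ?_)⟩
    · simp [THolds, h0]
    · simpa using hp
    · rw [Function.update_idem]
      exact hr

theorem Testable.isPrefix (w v : V) :
    Testable k (fun (t : RTree Sig rank) (ν : V → Pos t) => (ν w).1 <+: (ν v).1) := by
  refine .atom v (fun idx => loop (M := Unit) (fun _ =>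
    (prim (.test (.peb 0 (idx w)) true false)).bind fun b =>
      match b with
      | true => pureG (Sum.inr true)
      | false => (prim (.test (.chno 0 0) true false)).bind fun b =>
        match b with
        | true => pureG (Sum.inr false)
        | false => prim (.up 0 (Sum.inl ()))) ())
    fun idx t π ν hν => ?_
  generalize ν v = u
  have hu := reaches_root u
  induction hu using Relation.ReflTransGen.head_induction_on with
  | refl =>
    by_cases hw : ν w = rootPos t
    · refine ⟨true, rootPos t, by simp [hw],
        loop_exit (bind_run (prim_run (.testT ?_)) pureG_run)⟩
      simp [THolds, hν, hw]
    · refine ⟨false, rootPos t, ?_, loop_exit (bind_run (prim_run (.testF ?_))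
        (bind_run (prim_run (.testT ?_)) pureG_run))⟩
      · have : (ν w).1 ≠ [] := fun h => hw (Subtype.ext h)
        simpa [rootPos] using this
      · simpa [THolds, hν] using hw
      · simp only [THolds, Function.update_self]
        rfl
  | @head a c h _ ih =>
    obtain ⟨j, hj⟩ := h
    by_cases hw : ν w = a
    · refine ⟨true, a, by simp [hw],
        loop_exit (bind_run (prim_run (.testT ?_)) pureG_run)⟩
      simp [THolds, hν, hw]
    · obtain ⟨b, x, hb, hr⟩ := ih
      refine ⟨b, x, ?_, loop_cont (m' := ()) (bind_run (prim_run (.testF ?_))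
        (bind_run (prim_run (.testF ?_)) (prim_run (CStep.up (p := c) (j := j) ?_)))) ?_⟩
      · rw [hb, hj, List.prefix_concat_iff]
        have : ¬ (ν w).1 = c.1 ++ [j] := fun h => hw (Subtype.ext (h.trans hj.symm))
        simp [this]
      · simpa [THolds, hν] using hw
      · simp [THolds, hj, childNo_snoc]
      · simp [hj]
      · rw [Function.update_idem]
        exact hr

theorem list_lt_iff (p q : List ℕ) : p < q ↔ (p <+: q ∧ p ≠ q) ∨
    ∃ w i j, i < j ∧ w ++ [i] <+: p ∧ w ++ [j] <+: q := by
  induction p generalizing q with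
  | nil => cases q <;> simp
  | cons a p ih =>
    cases q with
    | nil => simp
    | cons b q =>
      rw [List.cons_lt_cons_iff, ih]
      constructor
      · rintro (h | ⟨rfl, (⟨h, h'⟩ | ⟨w, i, j, hij, h, h'⟩)⟩)
        · exact .inr ⟨[], a, b, h, by simp, by simp⟩
        · exact .inl ⟨by simpa using h, by simpa using h'⟩
        · exact .inr ⟨a :: w, i, j, hij, by simpa using h, by simpa using h'⟩
      · rintro (⟨h, h'⟩ | ⟨w, i, j, hij, h, h'⟩)
        · simp only [List.cons_prefix_cons] at h
          obtain ⟨rfl, h⟩ := h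
          exact .inr ⟨rfl, .inl ⟨h, by simpa using h'⟩⟩
        · cases w with
          | nil =>
            simp at h h'
            left; omega
          | cons c w =>
            simp only [List.cons_append, List.cons_prefix_cons] at h h'
            obtain ⟨rfl, h⟩ := h
            obtain ⟨rfl, h'⟩ := h'
            exact .inr ⟨rfl, .inr ⟨w, i, j, hij, h, h'⟩⟩

theorem Testable.lt (v w : V) :
    Testable k (fun (t : RTree Sig rank) (ν : V → Pos t) => ν v < ν w) := by
  have h : Testable k (fun (t : RTree Sig rank) (ν : V → Pos t) =>
      ((ν v).1 <+: (ν w).1 ∧ ¬ ν v = ν w) ∨ ∃ c a b : Pos t, ∃ i j : Fin (maxRank rank + 1),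
        i.1 < j.1 ∧ (IsChild a c ∧ IsChild b c) ∧ (childNo a.1 = i.1 ∧ childNo b.1 = j.1) ∧
        (a.1 <+: (ν v).1 ∧ b.1 <+: (ν w).1)) := by
    refine ((Testable.isPrefix _ _).and (Testable.eq _ _).not).or ?_
    refine .exPos (.exPos (.exPos (.exFin fun i => .exFin fun j => (Testable.const _).and ?_)))
    refine ((Testable.isChild (some none) (some (some none))).and
      (Testable.isChild none (some (some none)))).and
      (((Testable.chno _ (some none)).and (Testable.chno _ none)).and
      ((Testable.isPrefix (some none) (some (some (some v)))).and
        (Testable.isPrefix none (some (some (some w))))))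
  refine h.congr fun t ν => ?_
  rw [Pos.lt_def, list_lt_iff]
  refine or_congr (and_congr Iff.rfl (not_congr ⟨fun h => by rw [h], fun h => Subtype.ext h⟩)) ?_
  constructor
  · rintro ⟨c, a, b, i, j, hij, ⟨⟨i', hi⟩, ⟨j', hj⟩⟩, ⟨h1, h2⟩, h3, h4⟩
    rw [hi, childNo_snoc] at h1
    rw [hj, childNo_snoc] at h2
    rw [hi] at h3
    rw [hj] at h4
    exact ⟨c.1, i', j', by omega, h3, h4⟩
  · rintro ⟨c, i, j, hij, h1, h2⟩
    have ha : IsPos t (c ++ [i]) := by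
      obtain ⟨l, hl⟩ := h1
      exact isPos_of_append (hl ▸ (ν v).2)
    have hb : IsPos t (c ++ [j]) := by
      obtain ⟨l, hl⟩ := h2
      exact isPos_of_append (hl ▸ (ν w).2)
    have ha' := childNo_le (⟨_, ha⟩ : Pos t)
    have hb' := childNo_le (⟨_, hb⟩ : Pos t)
    simp only [childNo_snoc] at ha' hb'
    exact ⟨⟨c, isPos_of_append ha⟩, ⟨_, ha⟩, ⟨_, hb⟩, ⟨i + 1, by omega⟩, ⟨j + 1, by omega⟩,
      by simpa using hij, ⟨⟨i, rfl⟩, ⟨j, rfl⟩⟩, ⟨childNo_snoc _ _, childNo_snoc _ _⟩, h1, h2⟩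

end testable
end NestedPebbles

namespace NestedPebbles
section iter
set_option linter.unusedSectionVars false
variable {Sig : Type} [Fintype Sig] {rank : Sig → ℕ} {k : ℕ} [NeZero k]

def seqL {ι : Type} (f : ι → Gadget Sig k Unit) : List ι → Gadget Sig k Unit
  | [] => pureG ()
  | i :: l => (f i).bind fun _ => seqL f l

theorem seqL_run {t : RTree Sig rank} {f : Fin k → Gadget Sig k Unit} {π : List (Pos t)}
    {d : Fin k → Pos t}
    (hf : ∀ i hs, (f i).Run t (hs, π) () (Function.update hs i (d i), π)) :
    ∀ (l : List (Fin k)) (hs : Fin k → Pos t), (seqL f l).Run t (hs, π) ()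
      (fun j => if j ∈ l then d j else hs j, π)
  | [], hs => by
    simp only [List.not_mem_nil, if_false]
    exact pureG_run
  | i :: l, hs => by
    refine bind_run (hf i hs) ?_
    have h := seqL_run hf l (Function.update hs i (d i))
    have e : (fun j => if j ∈ i :: l then d j else hs j) =
        (fun j => if j ∈ l then d j else Function.update hs i (d i) j) := by
      funext j
      by_cases h1 : j ∈ l
      · simp [h1]
      · by_cases h2 : j = i
        · subst h2; simp
        · simp [h1, h2]
    rw [e]
    exact h

def dropL (m : ℕ) : List (Fin k) → Gadget Sig k Unit
  | [] => pureG ()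
  | i :: l => (prim (.drop i m ())).bind fun _ => dropL (m + 1) l

theorem dropL_run {t : RTree Sig rank} {hs : Fin k → Pos t} :
    ∀ (l : List (Fin k)) (m : ℕ) (π : List (Pos t)), π.length = m →
      (dropL m l : Gadget Sig k Unit).Run t (hs, π) () (hs, π ++ l.map hs)
  | [], m, π, h => by
    simp only [List.map_nil, List.append_nil]
    exact pureG_run
  | i :: l, m, π, h => by
    refine bind_run (e := ()) (prim_run (.drop h)) ?_
    have := dropL_run (hs := hs) l (m + 1) (π ++ [hs i]) (by simp [h])
    simpa using this

noncomputable def shift (rank : Sig → ℕ) (k m : ℕ) [NeZero k] : Gadget Sig k Unit :=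
  (seqL (fun i : Fin k => place rank i (m + k + i)) (List.finRange k)).bind fun _ =>
  (popN m (k + k)).bind fun _ => (dropL m (List.finRange k)).bind fun _ =>
  seqL (fun i => reset i) (List.finRange k)

theorem shift_run {t : RTree Sig rank} {m : ℕ} {π : List (Pos t)} (hm : π.length = m)
    (c d : Fin k → Pos t) :
    (shift rank k m).Run t (rootH k t, π ++ List.ofFn c ++ List.ofFn d) ()
      (rootH k t, π ++ List.ofFn d) := by
  have h1 := seqL_run (t := t) (f := fun i : Fin k => place rank i (m + k + i))
    (π := π ++ List.ofFn c ++ List.ofFn d) (d := d) (fun i hs => place_run i (by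
      rw [List.getElem?_append_right (by simp [hm])]
      simp [hm])) (List.finRange k) (rootH k t)
  simp only [List.mem_finRange, if_true] at h1
  refine bind_run h1 ?_
  refine bind_run (e := ()) (y := (d, π)) ?_ ?_
  · rw [List.append_assoc]
    exact popN_run hm _ _ (by simp)
  refine bind_run (e := ()) (dropL_run _ _ _ hm) ?_
  have h2 := seqL_run (t := t) (f := fun i : Fin k => reset i)
    (π := π ++ List.ofFn d) (d := rootH k t) (fun i hs => reset_run i hs _) (List.finRange k) d
  simp only [List.mem_finRange, if_true] at h2
  rw [List.ofFn_eq_map] at h2 ⊢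
  exact h2

/-- Testability of a predicate with parameters in `V` and two `k`-tuples. -/
def Testable3 (k : ℕ) {V : Type}
    (R : ∀ t : RTree Sig rank, (V → Pos t) → (Fin k → Pos t) → (Fin k → Pos t) → Prop) : Prop :=
  Testable k (fun (t : RTree Sig rank) (ν : (V ⊕ Fin k) ⊕ Fin k → Pos t) =>
    R t (fun v => ν (Sum.inl (Sum.inl v))) (fun i => ν (Sum.inl (Sum.inr i)))
      (fun i => ν (Sum.inr i)))

theorem Testable3.app {V W : Type}
    {R : ∀ t : RTree Sig rank, (V → Pos t) → (Fin k → Pos t) → (Fin k → Pos t) → Prop}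
    (h : Testable3 k R) (a : V → W) (b c : Fin k → W) :
    Testable k (fun (t : RTree Sig rank) (ν : W → Pos t) =>
      R t (fun v => ν (a v)) (fun i => ν (b i)) (fun i => ν (c i))) :=
  Testable.rename h (Sum.elim (Sum.elim a b) c)

section
variable {V M : Type}

def tryL (m : ℕ) (F : M → Gadget Sig k Bool) (H : Gadget Sig k Unit) (s : M) :
    List M → Gadget Sig k (M ⊕ M)
  | [] => pureG (Sum.inr s)
  | s' :: l => (F s').bind fun b =>
    match b with
    | true => H.bind fun _ => pureG (Sum.inl s')
    | false => tryL m F H s l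

theorem iter [Finite M]
    (T : M → M → ∀ t : RTree Sig rank, (V → Pos t) → (Fin k → Pos t) → (Fin k → Pos t) → Prop)
    (hT : ∀ s s', Testable3 k (T s s'))
    (m : ℕ) (idx : V → ℕ) :
    ∃ G : M → Gadget Sig k M, ∀ (t : RTree Sig rank) (π : List (Pos t)) (ν : V → Pos t),
      π.length = m → (∀ v, π[idx v]? = some (ν v)) →
      (∀ x y y' : M × (Fin k → Pos t), T x.1 y.1 t ν x.2 y.2 → T x.1 y'.1 t ν x.2 y'.2 → y = y') →
      ∀ x y : M × (Fin k → Pos t),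
      Relation.ReflTransGen (fun x y : M × (Fin k → Pos t) => T x.1 y.1 t ν x.2 y.2) x y →
      (∀ z : M × (Fin k → Pos t), ¬ T y.1 z.1 t ν y.2 z.2) →
      (G x.1).Run t (rootH k t, π ++ List.ofFn x.2) y.1 (rootH k t, π ++ List.ofFn y.2) := by
  have := Fintype.ofFinite M
  have hF : ∀ s s', ∃ G : Gadget Sig k Bool, ∀ (t : RTree Sig rank) (π : List (Pos t))
      (ν : V → Pos t) (c : Fin k → Pos t), π.length = m → (∀ v, π[idx v]? = some (ν v)) →
      (∃ d, T s s' t ν c d ∧ G.Run t (rootH k t, π ++ List.ofFn c) true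
        (rootH k t, π ++ List.ofFn c ++ List.ofFn d)) ∨
      ((∀ d, ¬ T s s' t ν c d) ∧
        G.Run t (rootH k t, π ++ List.ofFn c) false (rootH k t, π ++ List.ofFn c)) := by
    intro s s'
    have h : Findable k (V := V ⊕ Fin k) (n := k) (fun (t : RTree Sig rank) ν us =>
        T s s' t (fun v => ν (Sum.inl v)) (fun i => ν (Sum.inr i)) us) :=
      Testable.findable (hT s s')
    obtain ⟨G, hG⟩ := h (m + k) (Sum.elim idx (fun i => m + i))
    refine ⟨G, fun t π ν c hm hν => ?_⟩
    exact hG t (π ++ List.ofFn c) (Sum.elim ν c) (by simp [hm]) (by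
      rintro (v | i)
      · exact getElem?_append_of_some (hν v)
      · simp [← hm])
  choose F hF using hF
  refine ⟨fun s => loop (fun s => tryL m (F s) (shift rank k m) s Finset.univ.toList) s, ?_⟩
  intro t π ν hm hν hfun
  have hno : ∀ (s : M) (c : Fin k → Pos t), (∀ z : M × (Fin k → Pos t), ¬ T s z.1 t ν c z.2) →
      ∀ l, (tryL m (F s) (shift rank k m) s l).Run t (rootH k t, π ++ List.ofFn c) (Sum.inr s)
        (rootH k t, π ++ List.ofFn c) := by
    intro s c hc l
    induction l with
    | nil => exact pureG_run
    | cons s' l ih =>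
      rcases hF s s' t π ν c hm hν with ⟨d, hd, _⟩ | ⟨_, hr⟩
      · exact absurd hd (hc (s', d))
      · exact bind_run hr ih
  have hyes : ∀ (s s' : M) (c c' : Fin k → Pos t), T s s' t ν c c' → ∀ l, s' ∈ l →
      (tryL m (F s) (shift rank k m) s l).Run t (rootH k t, π ++ List.ofFn c) (Sum.inl s')
        (rootH k t, π ++ List.ofFn c') := by
    intro s s' c c' hc l
    induction l with
    | nil => intro h; simp at h
    | cons s1 l ih =>
      intro hmem
      rcases hF s s1 t π ν c hm hν with ⟨d, hd, hr⟩ | ⟨hn, hr⟩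
      · have := hfun (s, c) (s', c') (s1, d) hc hd
        obtain ⟨rfl, rfl⟩ := Prod.mk.inj this
        exact bind_run hr (bind_run (shift_run hm _ _) pureG_run)
      · have hne : s' ≠ s1 := by
          rintro rfl
          exact hn _ hc
        exact bind_run hr (ih (by simpa [hne] using hmem))
  intro x y hxy hy
  have h1 := loop_star (E := M) (t := t)
    (G := fun s => tryL m (F s) (shift rank k m) s Finset.univ.toList)
    (a := (x.1, (rootH k t, π ++ List.ofFn x.2)))
    (b := (y.1, (rootH k t, π ++ List.ofFn y.2))) (e := y.1)
    (z := (rootH k t, π ++ List.ofFn y.2)) ?_ ?_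
  · exact h1
  · refine Relation.ReflTransGen.lift (fun x : M × (Fin k → Pos t) =>
      (x.1, (rootH k t, π ++ List.ofFn x.2))) (fun a b hab => ?_) _ _ hxy
    exact hyes _ _ _ _ hab _ (by simp)
  · exact hno _ _ hy _

end
end iter

/-! #### Depth-first search -/

def dfs {C : Type} [LinearOrder C] (φ : C → C → Prop) (u : C) (b b' : Bool) (c d : C) : Prop :=
  match b, b' with
  | true, true => ¬ c = u ∧ IsFirst φ c d
  | true, false => ¬ c = u ∧ (∀ d', ¬ φ d' c) ∧ d = c
  | false, true => IsNext φ c d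
  | false, false => φ c d ∧ ∀ d', φ d' d → ¬ c < d'

theorem dfs_functional {C : Type} [LinearOrder C] (φ : C → C → Prop) (u : C)
    (hφ : ∀ a b b', φ a b → φ a b' → b = b') (b : Bool) (c : C) (b₁ b₂ : Bool) (d₁ d₂ : C)
    (h₁ : dfs φ u b b₁ c d₁) (h₂ : dfs φ u b b₂ c d₂) : b₁ = b₂ ∧ d₁ = d₂ := by
  cases b <;> cases b₁ <;> cases b₂ <;> simp only [dfs, IsFirst, IsNext] at h₁ h₂
  · exact ⟨rfl, hφ _ _ _ h₁.1 h₂.1⟩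
  · obtain ⟨p, h1, h2, h3, h4⟩ := h₂
    obtain rfl := hφ _ _ _ h₁.1 h1
    exact absurd h3 (h₁.2 _ h2)
  · obtain ⟨p, h1, h2, h3, h4⟩ := h₁
    obtain rfl := hφ _ _ _ h₂.1 h1
    exact absurd h3 (h₂.2 _ h2)
  · obtain ⟨p, h1, h2, h3, h4⟩ := h₁
    obtain ⟨p', h1', h2', h3', h4'⟩ := h₂
    obtain rfl := hφ _ _ _ h1 h1'
    exact ⟨rfl, le_antisymm (h4 _ h2' h3') (h4' _ h2 h3)⟩
  · exact ⟨rfl, h₁.2.2.trans h₂.2.2.symm⟩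
  · exact absurd h₂.2.1 (h₁.2.1 _)
  · exact absurd h₁.2.1 (h₂.2.1 _)
  · exact ⟨rfl, le_antisymm (h₁.2.2 _ h₂.2.1) (h₂.2.2 _ h₁.2.1)⟩

section dtc
set_option linter.unusedSectionVars false
variable {Sig : Type} [Fintype Sig] {rank : Sig → ℕ} {k : ℕ} [NeZero k]
variable {Q : Type} [LinearOrder Q] [Finite Q]

def CC (Q : Type) (k : ℕ) (t : RTree Sig rank) : Type := Q × (Fin k → Pos t)

instance (t : RTree Sig rank) : Finite (CC Q k t) :=
  inferInstanceAs (Finite (Q × (Fin k → Pos t)))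

def CC.toL {t : RTree Sig rank} (c : CC Q k t) : Q ×ₗ Lex (Fin k → Pos t) :=
  toLex (c.1, toLex c.2)

noncomputable instance (t : RTree Sig rank) : LinearOrder (CC Q k t) :=
  LinearOrder.lift' CC.toL (fun a b h => by
    have h1 := Prod.mk.inj (toLex.injective h)
    exact Prod.ext h1.1 (toLex.injective h1.2))

def CC.mk {t : RTree Sig rank} (q : Q) (a : Fin k → Pos t) : CC Q k t := (q, a)

theorem CC.lt_def {t : RTree Sig rank} (a b : CC Q k t) : a < b ↔
    a.1 < b.1 ∨ a.1 = b.1 ∧ ∃ i, (∀ j : Fin k, j < i → a.2 j = b.2 j) ∧ a.2 i < b.2 i := by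
  have : a < b ↔ a.toL < b.toL := Iff.rfl
  rw [this, CC.toL, CC.toL, Prod.Lex.toLex_lt_toLex]
  exact Iff.rfl

variable {W V : Type}

theorem Testable.exCC {P : ∀ t : RTree Sig rank, (W → Pos t) → CC Q k t → Prop}
    (h : ∀ q, Testable k (fun (t : RTree Sig rank) (ν : W ⊕ Fin k → Pos t) =>
      P t (fun v => ν (Sum.inl v)) (q, fun i => ν (Sum.inr i)))) :
    Testable k (fun (t : RTree Sig rank) ν => ∃ c, P t ν c) := by
  refine (Testable.exFin (P := fun (q : Q) (t : RTree Sig rank) (ν : W → Pos t) =>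
    ∃ us : Fin k → Pos t, P t ν (q, us)) fun q => Testable.exT (h q)).congr fun t ν => ?_
  exact ⟨fun ⟨q, us, h⟩ => ⟨_, h⟩, fun ⟨c, h⟩ => ⟨c.1, c.2, h⟩⟩

theorem Testable.allCC {P : ∀ t : RTree Sig rank, (W → Pos t) → CC Q k t → Prop}
    (h : ∀ q, Testable k (fun (t : RTree Sig rank) (ν : W ⊕ Fin k → Pos t) =>
      P t (fun v => ν (Sum.inl v)) (q, fun i => ν (Sum.inr i)))) :
    Testable k (fun (t : RTree Sig rank) ν => ∀ c, P t ν c) :=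
  (Testable.exCC (P := fun (t : RTree Sig rank) ν c => ¬ P t ν c)
    fun q => (h q).not).not.congr fun t ν => by simp

theorem Testable.eqCC (q q' : Q) (a b : Fin k → W) :
    Testable k (fun (t : RTree Sig rank) (ν : W → Pos t) =>
      ((q, fun i => ν (a i)) : CC Q k t) = (q', fun i => ν (b i))) := by
  refine ((Testable.const (q = q')).and (.allFin fun i : Fin k =>
    Testable.eq (a i) (b i))).congr fun t ν => ?_
  constructor
  · rintro ⟨h1, h2⟩
    exact Prod.ext h1 (funext h2)
  · intro h
    have := Prod.mk.inj h
    exact ⟨this.1, fun i => congrFun this.2 i⟩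

theorem Testable.ltCC (q q' : Q) (a b : Fin k → W) :
    Testable k (fun (t : RTree Sig rank) (ν : W → Pos t) =>
      CC.mk q (fun i => ν (a i)) < CC.mk q' (fun i => ν (b i))) := by
  refine ((Testable.const (q < q')).or ((Testable.const (q = q')).and
    (.exFin fun i : Fin k => (Testable.allFin fun j : Fin k => (Testable.const (j < i)).imp
      (Testable.eq (a j) (b j))).and (Testable.lt (a i) (b i))))).congr fun t ν => ?_
  rw [CC.lt_def]
  exact Iff.rfl

theorem Testable.leCC (q q' : Q) (a b : Fin k → W) :
    Testable k (fun (t : RTree Sig rank) (ν : W → Pos t) =>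
      CC.mk q (fun i => ν (a i)) ≤ CC.mk q' (fun i => ν (b i))) :=
  (Testable.ltCC q' q b a).not.congr fun t ν => not_lt

theorem dfs_testable {φ : ∀ t : RTree Sig rank, (W → Pos t) → CC Q k t → CC Q k t → Prop}
    {u : ∀ t : RTree Sig rank, (W → Pos t) → CC Q k t}
    (hφ : ∀ q q', Testable3 k (V := W) fun (t : RTree Sig rank) ν a b => φ t ν (q, a) (q', b))
    (q₀ : Q) (a₀ : Fin k → W) (hu : ∀ t ν, u t ν = (q₀, fun i => ν (a₀ i)))
    (b b' : Bool) (q q' : Q) :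
    Testable3 k (V := W) fun (t : RTree Sig rank) ν c d =>
      dfs (φ t ν) (u t ν) b b' (q, c) (q', d) := by
  have hS : Testable k (V := (W ⊕ Fin k) ⊕ Fin k) (fun (t : RTree Sig rank) ν =>
      ¬ ((q, fun i => ν (Sum.inl (Sum.inr i))) : CC Q k t) =
        u t (fun v => ν (Sum.inl (Sum.inl v)))) := by
    simp only [hu]
    exact (Testable.eqCC q q₀ (fun i => Sum.inl (Sum.inr i))
      (fun i => Sum.inl (Sum.inl (a₀ i)))).not
  cases b <;> cases b' <;> simp only [Testable3, dfs, IsFirst, IsNext]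
  · refine ((hφ q q').app (fun v => Sum.inl (Sum.inl v)) (fun i => Sum.inl (Sum.inr i))
      (fun i => Sum.inr i)).and (.allCC fun q1 => ?_)
    exact ((hφ q1 q').app (fun v => Sum.inl (Sum.inl (Sum.inl v))) (fun i => Sum.inr i)
      (fun i => Sum.inl (Sum.inr i))).imp
      (Testable.ltCC q q1 (fun i => Sum.inl (Sum.inl (Sum.inr i))) (fun i => Sum.inr i)).not
  · refine .exCC fun q1 => ?_
    refine ((hφ q q1).app (fun v => Sum.inl (Sum.inl (Sum.inl v)))
      (fun i => Sum.inl (Sum.inl (Sum.inr i))) (fun i => Sum.inr i)).and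
      (((hφ q' q1).app (fun v => Sum.inl (Sum.inl (Sum.inl v)))
      (fun i => Sum.inl (Sum.inr i)) (fun i => Sum.inr i)).and
      ((Testable.ltCC q q' (fun i => Sum.inl (Sum.inl (Sum.inr i)))
        (fun i => Sum.inl (Sum.inr i))).and (.allCC fun q2 => ?_)))
    exact ((hφ q2 q1).app (fun v => Sum.inl (Sum.inl (Sum.inl (Sum.inl v))))
      (fun i => Sum.inr i) (fun i => Sum.inl (Sum.inr i))).imp
      ((Testable.ltCC q q2 (fun i => Sum.inl (Sum.inl (Sum.inl (Sum.inr i))))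
        (fun i => Sum.inr i)).imp (Testable.leCC q' q2 (fun i => Sum.inl (Sum.inl (Sum.inr i)))
        (fun i => Sum.inr i)))
  · refine hS.and (.and (.allCC fun q1 => ?_) ?_)
    · exact ((hφ q1 q).app (fun v => Sum.inl (Sum.inl (Sum.inl v))) (fun i => Sum.inr i)
        (fun i => Sum.inl (Sum.inl (Sum.inr i)))).not
    · exact Testable.eqCC q' q (fun i => Sum.inr i) (fun i => Sum.inl (Sum.inr i))
  · refine hS.and (.and ?_ (.allCC fun q1 => ?_))
    · exact (hφ q' q).app (fun v => Sum.inl (Sum.inl v)) (fun i => Sum.inr i)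
        (fun i => Sum.inl (Sum.inr i))
    · exact ((hφ q1 q).app (fun v => Sum.inl (Sum.inl (Sum.inl v))) (fun i => Sum.inr i)
        (fun i => Sum.inl (Sum.inl (Sum.inr i)))).imp
        (Testable.leCC q' q1 (fun i => Sum.inl (Sum.inr i)) (fun i => Sum.inr i))

theorem dtc_ord {R : ∀ t : RTree Sig rank, (V → Pos t) → CC Q k t → CC Q k t → Prop}
    (hR : ∀ q q', Testable3 k fun (t : RTree Sig rank) ν a b => R t ν (q, a) (q', b))
    (hfun : ∀ t ν a b b', R t ν a b → R t ν a b' → b = b') (q q' : Q) :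
    Testable3 k fun (t : RTree Sig rank) ν a b =>
      Relation.ReflTransGen (R t ν) (q, a) (q', b) := by
  let W := (V ⊕ Fin k) ⊕ Fin k
  let u : ∀ t : RTree Sig rank, (W → Pos t) → CC Q k t :=
    fun t ν => (q, fun i => ν (Sum.inl (Sum.inr i)))
  let v : ∀ t : RTree Sig rank, (W → Pos t) → CC Q k t :=
    fun t ν => (q', fun i => ν (Sum.inr i))
  let φ : ∀ t : RTree Sig rank, (W → Pos t) → CC Q k t → CC Q k t → Prop :=
    fun t ν a b => R t (fun x => ν (Sum.inl (Sum.inl x))) a b ∧ ¬ a = v t ν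
  have hφ : ∀ q q', Testable3 k (V := W) fun (t : RTree Sig rank) ν a b =>
      φ t ν (q, a) (q', b) := by
    intro q1 q2
    exact ((hR q1 q2).app (fun v => Sum.inl (Sum.inl (Sum.inl (Sum.inl v))))
      (fun i => Sum.inl (Sum.inr i)) (fun i => Sum.inr i)).and
      (Testable.eqCC q1 q' (fun i => Sum.inl (Sum.inr i))
        (fun i => Sum.inl (Sum.inl (Sum.inr i)))).not
  have hT := fun b b' q1 q2 => dfs_testable (u := u) hφ q (fun i => Sum.inl (Sum.inr i))
    (fun t ν => rfl) b b' q1 q2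
  have hcopy : Findable k (V := W) (n := k) (fun (t : RTree Sig rank) ν us =>
      ∀ i, us i = ν (Sum.inr i)) := by
    apply Testable.findable
    exact .allFin fun i => Testable.eq (Sum.inr i) (Sum.inl (Sum.inr i))
  intro m idx
  obtain ⟨G0, hG0⟩ := hcopy m idx
  obtain ⟨G, hG⟩ := iter (M := Bool × Q) (fun s s' (t : RTree Sig rank) ν c d =>
    dfs (φ t ν) (u t ν) s.1 s'.1 (s.2, c) (s'.2, d)) (fun s s' => hT _ _ _ _) m idx
  refine ⟨G0.bind fun _ => (G (true, q')).bind fun s => (popN m k).bind fun _ => pureG s.1, ?_⟩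
  intro t π ν hm hν
  have hφf : ∀ a b b', φ t ν a b → φ t ν a b' → b = b' :=
    fun a b b' h h' => hfun _ _ _ _ _ h.1 h'.1
  have hv : ∀ d, ¬ φ t ν (v t ν) d := fun d h => h.2 rfl
  have hequiv : Relation.ReflTransGen (φ t ν) (u t ν) (v t ν) ↔
      Relation.ReflTransGen (R t (fun x => ν (Sum.inl (Sum.inl x)))) (u t ν) (v t ν) := by
    constructor
    · exact Relation.ReflTransGen.mono (fun a b h => h.1) _ _
    · generalize u t ν = u₀
      intro h
      induction h using Relation.ReflTransGen.head_induction_on with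
      | refl => exact .refl
      | @head a c h _ ih =>
        by_cases ha : a = v t ν
        · rw [ha]
        · exact .head ⟨h, ha⟩ ih
  have hrun0 : G0.Run t (rootH k t, π) true
      (rootH k t, π ++ List.ofFn (v t ν).2) := by
    rcases hG0 t π ν hm hν with ⟨us, hus, hr⟩ | ⟨hn, _⟩
    · have : us = (v t ν).2 := funext hus
      rw [← this]
      exact hr
    · exact absurd (fun i => rfl) (hn (v t ν).2)
  have hit := hG t π ν hm hν (by
    rintro ⟨⟨b, q1⟩, c⟩ ⟨⟨b1, q2⟩, d1⟩ ⟨⟨b2, q3⟩, d2⟩ h1 h2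
    obtain ⟨rfl, h4⟩ := dfs_functional (φ t ν) (u t ν) hφf _ _ _ _ _ _ h1 h2
    obtain ⟨rfl, rfl⟩ := Prod.mk.inj h4
    rfl)
  have htour := tour (C := CC Q k t) (St := (Bool × Q) × (Fin k → Pos t)) (φ t ν) hφf (v t ν) hv
    (fun c => c = u t ν)
    (fun x y => dfs (φ t ν) (u t ν) x.1.1 y.1.1 (x.1.2, x.2) (y.1.2, y.2))
    (fun c => ((true, c.1), c.2)) (fun c => ((false, c.1), c.2))
    (fun c d h h' => ⟨h, h'⟩) (fun c h h' => ⟨h, h', rfl⟩) (fun c d h => h)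
    (fun c p h h' => ⟨h, h'⟩) (v t ν) .refl
  rcases htour with ⟨w, hw, rfl, hrun⟩ | ⟨hn, hrun⟩
  · refine ⟨true, by simpa using hequiv.1 hw, ?_⟩
    have hr := hit _ _ hrun (by
      rintro ⟨⟨b, q1⟩, c⟩ h
      cases b
      · exact h.1 rfl
      · exact h.1 rfl)
    exact bind_run hrun0 (bind_run hr (bind_run (popN_run hm k _ (by simp)) pureG_run))
  · refine ⟨false, by simpa using fun h => hn _ (hequiv.2 h) rfl, ?_⟩
    have hr := hit _ _ hrun (by
      rintro ⟨⟨b, q1⟩, c⟩ h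
      cases b
      · exact hv _ h.1
      · obtain ⟨p, h, _⟩ := h
        exact hv _ h)
    exact bind_run hrun0 (bind_run hr (bind_run (popN_run hm k _ (by simp)) pureG_run))

end dtc

section dtc2
variable {Sig : Type} [Fintype Sig] {rank : Sig → ℕ} {k : ℕ} [NeZero k] {Q V : Type}

/-- Deterministic transitive closure preserves testability. -/
theorem dtc [Finite Q]
    {R : ∀ t : RTree Sig rank, (V → Pos t) → Q × (Fin k → Pos t) → Q × (Fin k → Pos t) → Prop}
    (hR : ∀ q q', Testable3 k fun (t : RTree Sig rank) ν a b => R t ν (q, a) (q', b))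
    (hfun : ∀ t ν a b b', R t ν a b → R t ν a b' → b = b') (q q' : Q) :
    Testable3 k fun (t : RTree Sig rank) ν a b =>
      Relation.ReflTransGen (R t ν) (q, a) (q', b) := by
  have := Fintype.ofFinite Q
  let _ : LinearOrder Q := LinearOrder.lift' (Fintype.equivFin Q) (Fintype.equivFin Q).injective
  exact dtc_ord hR hfun q q'

end dtc2
end NestedPebbles

namespace NestedPebbles

section step
variable {Sig : Type} {rank : Sig → ℕ} {k : ℕ}

theorem instrStep_functional {t : RTree Sig rank} {X : Type} {ins : TInstr Sig k X}
    {hs h₁ h₂ : Fin k → Pos t} {π π₁ π₂ : List (X × Pos t)}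
    (a : instrStep t ins hs π h₁ π₁) (b : instrStep t ins hs π h₂ π₂) : h₁ = h₂ ∧ π₁ = π₂ := by
  cases ins with
  | up i =>
    obtain ⟨rfl, ⟨j, hj⟩, h⟩ := a
    obtain ⟨rfl, ⟨j', hj'⟩, h'⟩ := b
    refine ⟨funext fun m => ?_, rfl⟩
    by_cases hm : m = i
    · subst hm
      rw [hj] at hj'
      exact Subtype.ext (List.append_inj' hj' rfl).1
    · rw [h m hm, h' m hm]
  | down i j =>
    obtain ⟨rfl, _, hj, h⟩ := a
    obtain ⟨rfl, _, hj', h'⟩ := b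
    refine ⟨funext fun m => ?_, rfl⟩
    by_cases hm : m = i
    · subst hm
      exact Subtype.ext (hj.trans hj'.symm)
    · rw [h m hm, h' m hm]
  | dropPeb i x =>
    exact ⟨a.1.trans b.1.symm, a.2.1.trans b.2.1.symm⟩
  | retrieve x =>
    obtain ⟨rfl, w, h⟩ := a
    obtain ⟨rfl, w', h'⟩ := b
    rw [h] at h'
    exact ⟨rfl, (List.cons.inj h').2⟩
  | test b τ => exact ⟨a.1.trans b.1.symm, a.2.1.trans b.2.1.symm⟩

theorem negOf_absurd {t : RTree Sig rank} {X : Type} {i₁ i₂ : TInstr Sig k X}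
    {hs h₁ h₂ : Fin k → Pos t} {π π₁ π₂ : List (X × Pos t)} (h : negOf i₁ i₂)
    (a : instrStep t i₁ hs π h₁ π₁) (b : instrStep t i₂ hs π h₂ π₂) : False := by
  obtain ⟨c, τ, rfl, rfl⟩ := h
  have h1 := a.2.2
  have h2 := b.2.2
  rw [h1] at h2
  cases c <;> simp at h2

theorem Step.functional {A : TWA Sig rank k} (hd : Deterministic A) {t : RTree Sig rank}
    {c d e : TConf A t} (h : Step A t c d) (h' : Step A t c e) : d = e := by
  obtain ⟨i₁, m₁, s₁⟩ := h
  obtain ⟨i₂, m₂, s₂⟩ := h'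
  by_cases hne : (i₁, d.1) = (i₂, e.1)
  · obtain ⟨rfl, h2⟩ := Prod.mk.inj hne
    obtain ⟨h3, h4⟩ := instrStep_functional s₁ s₂
    exact Prod.ext h2 (Prod.ext h3 h4)
  · rcases hd _ _ _ _ _ m₁ m₂ hne with hn | hn
    · exact (negOf_absurd hn s₁ s₂).elim
    · exact (negOf_absurd hn s₂ s₁).elim

variable (A : TWA Sig rank k) (t : RTree Sig rank)

theorem Step.shape {A : TWA Sig rank k} {t : RTree Sig rank} {q q' : A.Q}
    {a b : Fin k → Pos t} {σ τ : List (A.X × Pos t)} (h : Step A t (q, a, σ) (q', b, τ)) :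
    τ = σ ∨ (∃ p, τ = p :: σ) ∨ ∃ p, σ = p :: τ := by
  obtain ⟨ins, _, h⟩ := h
  cases ins with
  | up i => exact .inl h.1
  | down i j => exact .inl h.1
  | dropPeb i x => exact .inr (.inl ⟨_, h.2.1⟩)
  | retrieve x =>
    obtain ⟨_, w, h⟩ := h
    exact .inr (.inr ⟨_, h⟩)
  | test b τ => exact .inl h.2.1

/-- Runs that start and end with stack `σ` and never touch `σ`. -/
inductive LR : List (A.X × Pos t) → A.Q × (Fin k → Pos t) → A.Q × (Fin k → Pos t) → Prop
  | refl {σ a} : LR σ a a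
  | plain {σ a b c} : Step A t (a.1, a.2, σ) (b.1, b.2, σ) → LR σ b c → LR σ a c
  | call {σ p a a' b' b c} : Step A t (a.1, a.2, σ) (a'.1, a'.2, p :: σ) → LR (p :: σ) a' b' →
      Step A t (b'.1, b'.2, p :: σ) (b.1, b.2, σ) → LR σ b c → LR σ a c

def LS (σ : List (A.X × Pos t)) (a b : A.Q × (Fin k → Pos t)) : Prop :=
  Step A t (a.1, a.2, σ) (b.1, b.2, σ) ∨ ∃ p a' b',
    Step A t (a.1, a.2, σ) (a'.1, a'.2, p :: σ) ∧ LR A t (p :: σ) a' b' ∧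
      Step A t (b'.1, b'.2, p :: σ) (b.1, b.2, σ)

variable {A t}

theorem LR_iff {σ : List (A.X × Pos t)} {a b : A.Q × (Fin k → Pos t)} :
    LR A t σ a b ↔ Relation.ReflTransGen (LS A t σ) a b := by
  constructor
  · intro h
    induction h with
    | refl => exact .refl
    | plain h _ ih => exact .head (.inl h) ih
    | call h1 h2 h3 _ _ ih => exact .head (.inr ⟨_, _, _, h1, h2, h3⟩) ih
  · intro h
    induction h using Relation.ReflTransGen.head_induction_on with
    | refl => exact .refl
    | head h _ ih =>
      rcases h with h | ⟨p, a', b', h1, h2, h3⟩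
      · exact .plain h ih
      · exact .call h1 h2 h3 ih

theorem LR.trans {σ : List (A.X × Pos t)} {a b c : A.Q × (Fin k → Pos t)}
    (h : LR A t σ a b) (h' : LR A t σ b c) : LR A t σ a c :=
  LR_iff.2 ((LR_iff.1 h).trans (LR_iff.1 h'))

theorem LR.sound {σ : List (A.X × Pos t)} {a b : A.Q × (Fin k → Pos t)} (h : LR A t σ a b) :
    Relation.ReflTransGen (Step A t) (a.1, a.2, σ) (b.1, b.2, σ) := by
  induction h with
  | refl => exact .refl
  | plain h _ ih => exact .head h ih
  | call h1 h2 h3 _ ih1 ih => exact .head h1 (ih1.trans (.head h3 ih))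

def Inv (a : A.Q × (Fin k → Pos t)) : List (A.X × Pos t) → A.Q × (Fin k → Pos t) → Prop
  | [], b => LR A t [] a b
  | p :: σ, b => ∃ c d, Inv a σ c ∧ Step A t (c.1, c.2, σ) (d.1, d.2, p :: σ) ∧
      LR A t (p :: σ) d b

theorem Inv.extend {a : A.Q × (Fin k → Pos t)} {σ : List (A.X × Pos t)}
    {b c : A.Q × (Fin k → Pos t)} (h : Inv a σ b) (h' : LR A t σ b c) : Inv a σ c := by
  cases σ with
  | nil => exact LR.trans h h'
  | cons p σ =>
    obtain ⟨x, y, h1, h2, h3⟩ := h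
    exact ⟨x, y, h1, h2, h3.trans h'⟩

theorem LR.complete {a b : A.Q × (Fin k → Pos t)}
    (h : Relation.ReflTransGen (Step A t) (a.1, a.2, []) (b.1, b.2, [])) : LR A t [] a b := by
  have key : ∀ x, Relation.ReflTransGen (Step A t) (a.1, a.2, []) x → Inv a x.2.2 (x.1, x.2.1) := by
    intro x hx
    induction hx with
    | refl => exact LR.refl
    | @tail y z _ hyz ih =>
      obtain ⟨q, hs, σ⟩ := y
      obtain ⟨q', hs', τ⟩ := z
      rcases hyz.shape with rfl | ⟨p, rfl⟩ | ⟨p, rfl⟩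
      · exact ih.extend (.plain hyz .refl)
      · exact ⟨(q, hs), (q', hs'), ih, hyz, .refl⟩
      · obtain ⟨c, d, h1, h2, h3⟩ := ih
        exact h1.extend (.call h2 h3 hyz .refl)
  exact key _ h

theorem LR.pop_unique (hd : Deterministic A) {σ : List (A.X × Pos t)}
    {a b : A.Q × (Fin k → Pos t)} (h : LR A t σ a b) :
    ∀ b', LR A t σ a b' →
      (∃ q c τ, Step A t (b.1, b.2, σ) (q, c, τ) ∧ τ.length < σ.length) →
      (∃ q c τ, Step A t (b'.1, b'.2, σ) (q, c, τ) ∧ τ.length < σ.length) → b = b' := by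
  induction h with
  | refl =>
    intro b' h' ⟨q, c, τ, h1, h2⟩ _
    cases h' with
    | refl => rfl
    | plain h3 _ =>
      have := Step.functional hd h1 h3
      simp only [Prod.mk.injEq] at this
      obtain ⟨_, _, rfl⟩ := this
      omega
    | call h3 =>
      have := Step.functional hd h1 h3
      simp only [Prod.mk.injEq] at this
      obtain ⟨_, _, rfl⟩ := this
      simp at h2
  | @plain σ a b c hs _ ih =>
    intro b' h' hp ⟨q, e, τ, h1, h2⟩
    cases h' with
    | refl =>
      have := Step.functional hd h1 hs
      simp only [Prod.mk.injEq] at this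
      obtain ⟨_, _, rfl⟩ := this
      omega
    | plain h3 h4 =>
      have := Step.functional hd hs h3
      simp only [Prod.mk.injEq] at this
      rw [Prod.ext this.1 this.2.1] at ih
      exact ih _ h4 hp ⟨q, e, τ, h1, h2⟩
    | call h3 =>
      have := Step.functional hd hs h3
      simp at this
  | @call σ p a a' b' b c hs _ hs' _ ih1 ih2 =>
    intro d' h' hp ⟨q, e, τ, h1, h2⟩
    cases h' with
    | refl =>
      have := Step.functional hd h1 hs
      simp only [Prod.mk.injEq] at this
      obtain ⟨_, _, rfl⟩ := this
      simp at h2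
    | plain h3 h4 =>
      have := Step.functional hd hs h3
      simp at this
    | call h3 h4 h5 h6 =>
      have := Step.functional hd hs h3
      simp only [Prod.mk.injEq, List.cons.injEq, and_true] at this
      obtain ⟨e1, e2, rfl⟩ := this
      rw [← Prod.ext e1 e2] at h4
      obtain rfl := ih1 _ h4 ⟨_, _, _, hs', by simp⟩ ⟨_, _, _, h5, by simp⟩
      have := Step.functional hd hs' h5
      simp only [Prod.mk.injEq] at this
      rw [← Prod.ext this.1 this.2.1] at h6
      exact ih2 _ h6 hp ⟨q, e, τ, h1, h2⟩

theorem LS.functional (hd : Deterministic A) {σ : List (A.X × Pos t)}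
    {a b c : A.Q × (Fin k → Pos t)} (h : LS A t σ a b) (h' : LS A t σ a c) : b = c := by
  rcases h with h | ⟨p, x, y, h1, h2, h3⟩ <;> rcases h' with h' | ⟨p', x', y', h1', h2', h3'⟩
  · have := Step.functional hd h h'
    simp only [Prod.mk.injEq] at this
    exact Prod.ext this.1 this.2.1
  · have := Step.functional hd h h1'
    simp at this
  · have := Step.functional hd h' h1
    simp at this
  · have := Step.functional hd h1 h1'
    simp only [Prod.mk.injEq, List.cons.injEq, and_true] at this
    obtain ⟨e1, e2, rfl⟩ := this
    rw [← Prod.ext e1 e2] at h2'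
    obtain rfl := h2.pop_unique hd _ h2' ⟨_, _, _, h3, by simp⟩ ⟨_, _, _, h3', by simp⟩
    have := Step.functional hd h3 h3'
    simp only [Prod.mk.injEq] at this
    exact Prod.ext this.1 this.2.1

end step

section toTest
variable {Sig : Type} [Fintype Sig] {rank : Sig → ℕ} {k : ℕ} [NeZero k]

def mkStack {X : Type} {t : RTree Sig rank} (L : List X) (ρ : X → Pos t) : List (X × Pos t) :=
  L.map fun x => (x, ρ x)

theorem plain_testable {X : Type} (L : List X) (ins : TInstr Sig k X) :
    Testable3 k (fun (t : RTree Sig rank) (ρ : X → Pos t) a b =>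
      instrStep t ins a (mkStack L ρ) b (mkStack L ρ)) := by
  have hoth : ∀ i : Fin k, Testable3 k (fun (t : RTree Sig rank) (_ : X → Pos t)
      (a b : Fin k → Pos t) => ∀ h, h ≠ i → b h = a h) := fun i =>
    .allFin fun h => (Testable.const _).imp (Testable.eq (Sum.inr h) (Sum.inl (Sum.inr h)))
  cases ins with
  | up i =>
    refine ((Testable.isChild (Sum.inl (Sum.inr i)) (Sum.inr i)).and (hoth i)).congr
      fun t ν => ?_
    simp [instrStep, IsChild]
  | down i j =>
    refine (((Testable.const (1 ≤ j)).and ((Testable.isChild (Sum.inr i)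
      (Sum.inl (Sum.inr i))).and (Testable.chno j (Sum.inr i)))).and (hoth i)).congr
      fun t ν => ?_
    simp only [instrStep, IsChild, true_and, and_assoc]
    refine and_congr_right fun hj => ?_
    rw [← and_assoc]
    refine and_congr_left fun _ => ?_
    constructor
    · rintro ⟨⟨j', h⟩, h'⟩
      rw [h, childNo_snoc] at h'
      rw [h, ← h']
      rfl
    · intro h
      refine ⟨⟨_, h⟩, ?_⟩
      rw [h, childNo_snoc]
      omega
  | dropPeb i x => exact (Testable.const False).congr fun t ν => by simp [instrStep]
  | retrieve x => exact (Testable.const False).congr fun t ν => by simp [instrStep]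
  | test b τ =>
    have heq : Testable3 k (fun (t : RTree Sig rank) (_ : X → Pos t)
      (a b : Fin k → Pos t) => b = a) :=
      (Testable.allFin fun h => (Testable.eq (Sum.inr h) (Sum.inl (Sum.inr h)))).congr
        fun t ν => funext_iff.symm
    have hτ : Testable3 k (fun (t : RTree Sig rank) (ρ : X → Pos t)
        (a _ : Fin k → Pos t) => testHolds t τ a (mkStack L ρ)) := by
      cases τ with
      | lab i a => exact Testable.lab a (Sum.inl (Sum.inr i))
      | chno i j => exact Testable.chno j (Sum.inl (Sum.inr i))
      | peb i x =>
        refine ((Testable.const (x ∈ L)).and (Testable.eq (Sum.inl (Sum.inl x))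
          (Sum.inl (Sum.inr i)))).congr fun t ν => ?_
        simp only [testHolds, mkStack, List.mem_map, Prod.mk.injEq]
        constructor
        · rintro ⟨h1, h2⟩
          exact ⟨x, h1, rfl, h2⟩
        · rintro ⟨y, h1, rfl, h2⟩
          exact ⟨h1, h2⟩
    refine (Testable.and heq (Testable.iff_const hτ (b = true))).congr fun t ν => ?_
    simp [instrStep]

theorem step_testable (A : TWA Sig rank k) (L : List A.X) (q q' : A.Q) :
    Testable3 k (fun (t : RTree Sig rank) (ρ : A.X → Pos t) a b =>
      Step A t (q, a, mkStack L ρ) (q', b, mkStack L ρ)) := by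
  have := A.instrFin.to_subtype
  refine (Testable.exFin fun p : A.instr => (Testable.const (p.1.1 = q ∧ p.1.2.2 = q')).and
    (plain_testable L p.1.2.1)).congr fun t ν => ?_
  constructor
  · rintro ⟨⟨⟨_, ins, _⟩, hp⟩, ⟨rfl, rfl⟩, h⟩
    exact ⟨ins, hp, h⟩
  · rintro ⟨ins, hp, h⟩
    exact ⟨⟨_, hp⟩, ⟨rfl, rfl⟩, h⟩

open Classical in
theorem LS_testable (A : TWA Sig rank k) (L : List A.X)
    (H : ∀ x, x ∉ L → ∀ q q', Testable3 k (fun (t : RTree Sig rank) (ρ : A.X → Pos t) a b =>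
      LR A t (mkStack (x :: L) ρ) (q, a) (q', b))) (q q' : A.Q) :
    Testable3 k (fun (t : RTree Sig rank) (ρ : A.X → Pos t) a b =>
      LS A t (mkStack L ρ) (q, a) (q', b)) := by
  have := A.finX
  have := A.finQ
  refine Testable.or (step_testable A L q q') ?_
  have h : Testable3 k (fun (t : RTree Sig rank) (ρ : A.X → Pos t) a b =>
      ∃ (x : {x // x ∉ L}) (i : Fin k) (q₁ q₂ : A.Q),
      ((q, .dropPeb i x.1, q₁) ∈ A.instr ∧ (q₂, .retrieve x.1, q') ∈ A.instr) ∧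
      LR A t (mkStack (x.1 :: L) (Function.update ρ x.1 (a i))) (q₁, a) (q₂, b)) := by
    refine .exFin fun x => .exFin fun i => .exFin fun q₁ => .exFin fun q₂ =>
      (Testable.const _).and ?_
    refine ((H x.1 x.2 q₁ q₂).app (fun v => if v = x.1 then Sum.inl (Sum.inr i) else
      Sum.inl (Sum.inl v)) (fun i => Sum.inl (Sum.inr i)) (fun i => Sum.inr i)).congr
      fun t ν => ?_
    have : (fun v => ν (if v = x.1 then Sum.inl (Sum.inr i) else Sum.inl (Sum.inl v))) =
        Function.update (fun v => ν (Sum.inl (Sum.inl v))) x.1 (ν (Sum.inl (Sum.inr i))) := by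
      funext v
      by_cases hv : v = x.1
      · simp [hv]
      · simp [hv]
    rw [this]
  have hst : ∀ (t : RTree Sig rank) (ρ : A.X → Pos t) (x : A.X) (p : Pos t), x ∉ L →
      mkStack (x :: L) (Function.update ρ x p) = (x, p) :: mkStack L ρ := by
    intro t ρ x p hx
    simp only [mkStack, List.map_cons, Function.update_self, List.cons.injEq, true_and]
    refine List.map_congr_left fun y hy => ?_
    have : y ≠ x := fun h => hx (h ▸ hy)
    simp [this]
  refine h.congr fun t ν => ?_
  generalize (fun v => ν (Sum.inl (Sum.inl v))) = ρ
  generalize (fun v => ν (Sum.inl (Sum.inr v))) = a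
  generalize (fun v => ν (Sum.inr v)) = b
  constructor
  · rintro ⟨⟨x, hx⟩, i, q₁, q₂, ⟨h1, h2⟩, h3⟩
    rw [hst _ _ _ _ hx] at h3
    refine ⟨(x, a i), (q₁, a), (q₂, b), ⟨.dropPeb i x, h1, rfl, rfl, ?_⟩, h3,
      ⟨.retrieve x, h2, rfl, _, rfl⟩⟩
    intro w hw
    simp only [mkStack, List.mem_map, Prod.mk.injEq] at hw
    obtain ⟨y, hy, rfl, _⟩ := hw
    exact hx hy
  · rintro ⟨⟨x, w⟩, ⟨q₁, a'⟩, ⟨q₂, b'⟩, ⟨ins, h1, s1⟩, h3, ⟨ins', h2, s2⟩⟩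
    obtain ⟨i, rfl, rfl, rfl, hx⟩ : ∃ i, ins = .dropPeb i x ∧ a' = a ∧ w = a i ∧ x ∉ L := by
      cases ins with
      | up i => simp [instrStep] at s1
      | down i j => simp [instrStep] at s1
      | dropPeb i y =>
        obtain ⟨e1, e2, e3⟩ := s1
        simp only [List.cons.injEq, Prod.mk.injEq, and_true] at e2
        obtain ⟨rfl, e2⟩ := e2
        refine ⟨i, rfl, e1, e2, fun hx => e3 (ρ x) ?_⟩
        exact List.mem_map_of_mem (f := fun x => (x, ρ x)) hx
      | retrieve y =>
        obtain ⟨_, w', e⟩ := s1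
        have := congrArg List.length e
        simp at this
        omega
      | test b τ => simp [instrStep] at s1
    obtain ⟨rfl, rfl⟩ : ins' = .retrieve x ∧ b' = b := by
      cases ins' with
      | up i => simp [instrStep] at s2
      | down i j => simp [instrStep] at s2
      | dropPeb i y =>
        obtain ⟨e1, e2, e3⟩ := s2
        have := congrArg List.length e2
        simp at this
        omega
      | retrieve y =>
        obtain ⟨e1, w', e⟩ := s2
        simp only [List.cons.injEq, Prod.mk.injEq, and_true] at e
        exact ⟨by rw [e.1], e1.symm⟩
      | test b τ => simp [instrStep] at s2
    refine ⟨⟨x, hx⟩, i, q₁, q₂, ⟨h1, h2⟩, ?_⟩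
    rw [hst _ _ _ _ hx]
    exact h3

theorem LR_testable (A : TWA Sig rank k) (hd : Deterministic A) :
    ∀ (n : ℕ) (L : List A.X), L.Nodup → Nat.card A.X ≤ L.length + n → ∀ q q',
    Testable3 k (fun (t : RTree Sig rank) (ρ : A.X → Pos t) a b =>
      LR A t (mkStack L ρ) (q, a) (q', b)) := by
  have := A.finX
  have := A.finQ
  have main : ∀ L : List A.X, (∀ x, x ∉ L → ∀ q q',
      Testable3 k (fun (t : RTree Sig rank) (ρ : A.X → Pos t) a b =>
        LR A t (mkStack (x :: L) ρ) (q, a) (q', b))) → ∀ q q',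
      Testable3 k (fun (t : RTree Sig rank) (ρ : A.X → Pos t) a b =>
        LR A t (mkStack L ρ) (q, a) (q', b)) := by
    intro L H q q'
    have := dtc (R := fun (t : RTree Sig rank) (ρ : A.X → Pos t) a b => LS A t (mkStack L ρ) a b)
      (LS_testable A L H) (fun t ν a b b' h h' => h.functional hd h') q q'
    simp only [LR_iff]
    exact this
  intro n
  induction n with
  | zero =>
    intro L hL hn
    refine main L fun x hx => ?_
    exfalso
    have h1 : (x :: L).Nodup := List.nodup_cons.2 ⟨hx, hL⟩
    have h2 := h1.length_le_card
    rw [← Nat.card_eq_fintype_card] at h2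
    simp only [List.length_cons] at h2
    omega
  | succ n ih =>
    intro L hL hn
    refine main L fun x hx => ?_
    refine ih (x :: L) (List.nodup_cons.2 ⟨hx, hL⟩) ?_
    simp only [List.length_cons]
    omega

theorem lang_testable (A : TWA Sig rank k) (hd : Deterministic A) :
    Testable k (V := Empty) (fun (t : RTree Sig rank) _ => t ∈ Lang A) := by
  have := A.finX
  have := A.finQ
  have hLR := LR_testable A hd (Nat.card A.X) [] List.nodup_nil (by simp)
  have hst := step_testable A []
  have h : Testable k (V := Empty) (fun (t : RTree Sig rank) _ => ∃ u : Pos t, childNo u.1 = 0 ∧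
      ∃ q : A.acc, LR A t [] (A.q0, fun _ => u) (q.1, fun _ => u) ∧
      (¬ ∃ q', ∃ b : Fin k → Pos t, Step A t (q.1, (fun _ => u), []) (q', b, [])) ∧
      ¬ ∃ i x q', (q.1, .dropPeb i x, q') ∈ A.instr) := by
    refine .exPos ((Testable.chno 0 none).and (.exFin fun q => .and ?_ (.and
      (.not (.exFin fun q' => .exT ?_)) (.const _))))
    · exact (hLR A.q0 q.1).app (fun _ => none) (fun _ => none) (fun _ => none)
    · exact (hst q.1 q').app (fun _ => Sum.inl none) (fun _ => Sum.inl none) (fun i => Sum.inr i)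
  refine h.congr fun t ν => ?_
  have hroot : ∀ u : Pos t, childNo u.1 = 0 ↔ u = rootPos t := fun u =>
    ⟨fun h => Subtype.ext (childNo_eq_zero.1 h), fun h => by rw [h]; rfl⟩
  simp only [hroot, exists_eq_left]
  have hhalt : ∀ q : A.Q, HaltingConf A t (q, (fun _ => rootPos t), []) ↔
      (¬ ∃ q', ∃ b : Fin k → Pos t, Step A t (q, (fun _ => rootPos t), []) (q', b, [])) ∧
      ¬ ∃ i x q', (q, .dropPeb i x, q') ∈ A.instr := by
    intro q
    constructor
    · intro h
      refine ⟨fun ⟨q', b, hs⟩ => h _ hs, fun ⟨i, x, q', hm⟩ => ?_⟩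
      exact h (q', (fun _ => rootPos t), [(x, rootPos t)]) ⟨_, hm, rfl, rfl, by simp⟩
    · rintro ⟨h1, h2⟩ ⟨q', b, τ⟩ hs
      rcases hs.shape with rfl | ⟨p, rfl⟩ | ⟨p, hp⟩
      · exact h1 ⟨_, _, hs⟩
      · obtain ⟨ins, hm, hi⟩ := hs
        cases ins with
        | up i => simp [instrStep] at hi
        | down i j => simp [instrStep] at hi
        | dropPeb i x => exact h2 ⟨_, _, _, hm⟩
        | retrieve x => simp [instrStep] at hi
        | test b τ => simp [instrStep] at hi
      · simp at hp
  constructor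
  · rintro ⟨⟨q, hq⟩, h1, h2⟩
    exact ⟨q, hq, h1.sound, (hhalt q).2 h2⟩
  · rintro ⟨q, hq, h1, h2⟩
    exact ⟨⟨q, hq⟩, LR.complete (a := (A.q0, fun _ => rootPos t))
      (b := (q, fun _ => rootPos t)) h1, (hhalt q).1 h2⟩

end toTest
end NestedPebbles

namespace NestedPebbles
section toTWA
variable {Sig : Type} {rank : Sig → ℕ} {k : ℕ}

def TTest.pebNo : TTest Sig k ℕ → ℕ
  | .peb _ x => x
  | _ => 0

def Cmd.pebNo {α : Type} : Cmd Sig k α → ℕ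
  | .drop _ x _ => x
  | .retr x _ => x
  | .test τ _ _ => τ.pebNo
  | _ => 0

def TTest.mapX {X Y : Type} (f : X → Y) : TTest Sig k X → TTest Sig k Y
  | .lab i a => .lab i a
  | .peb i x => .peb i (f x)
  | .chno i j => .chno i j

def Cmd.ins {α X : Type} (f : ℕ → X) : Cmd Sig k α → List (TInstr Sig k X × α)
  | .up i a => [(.up i, a)]
  | .down i j a => [(.down i j, a)]
  | .drop i x a => [(.dropPeb i (f x), a)]
  | .retr x a => [(.retrieve (f x), a)]
  | .test τ a b => [(.test true (τ.mapX f), a), (.test false (τ.mapX f), b)]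

def enc {X P : Type} (f : ℕ → X) (π : List P) : List (X × P) :=
  (π.zipIdx.map fun p => (f p.2, p.1)).reverse

theorem enc_snoc {X P : Type} (f : ℕ → X) (π : List P) (u : P) :
    enc f (π ++ [u]) = (f π.length, u) :: enc f π := by
  simp [enc, List.zipIdx_append]

theorem mem_enc {X P : Type} {f : ℕ → X} {N : ℕ} (hf : ∀ x y, x ≤ N → y ≤ N → f x = f y → x = y)
    {π : List P} (hπ : π.length ≤ N + 1) {x : ℕ} (hx : x ≤ N) {p : P} :
    (f x, p) ∈ enc f π ↔ π[x]? = some p := by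
  simp only [enc, List.mem_reverse, List.mem_map, Prod.mk.injEq]
  constructor
  · rintro ⟨⟨u, i⟩, h1, h2, h3⟩
    rw [List.mem_zipIdx_iff_getElem?] at h1
    simp only at h1 h2 h3
    obtain ⟨h4, _⟩ := List.getElem?_eq_some_iff.1 h1
    obtain rfl := hf i x (by omega) hx h2
    rw [h1, h3]
  · intro h
    exact ⟨(p, x), List.mem_zipIdx_iff_getElem?.2 h, rfl, rfl⟩

theorem CStep.sim {t : RTree Sig rank} {α X : Type} {f : ℕ → X} {N : ℕ}
    (hf : ∀ x y, x ≤ N → y ≤ N → f x = f y → x = y) {c : Cmd Sig k α} (hc : c.pebNo ≤ N)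
    {x y : GC k t} {a : α} (h : CStep t c x a y) (hx : x.2.length ≤ N + 1) :
    y.2.length ≤ N + 1 ∧ ∃ i, (i, a) ∈ c.ins f ∧
      instrStep t i x.1 (enc f x.2) y.1 (enc f y.2) := by
  have hT : ∀ (τ : TTest Sig k ℕ) (hs : Fin k → Pos t) (π : List (Pos t)), τ.pebNo ≤ N →
      π.length ≤ N + 1 → (testHolds t (τ.mapX f) hs (enc f π) ↔ THolds t τ hs π) := by
    intro τ hs π hτ hπ
    cases τ with
    | lab i a => exact Iff.rfl
    | chno i j => exact Iff.rfl
    | peb i x => exact mem_enc hf hπ hτ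
  cases h with
  | @up i a hs π p j h =>
    refine ⟨hx, _, List.mem_singleton_self _, rfl, ⟨j, ?_⟩, ?_⟩
    · simpa using h
    · intro h hh
      simp [hh]
  | down h h' =>
    refine ⟨hx, _, List.mem_singleton_self _, rfl, h, ?_, ?_⟩
    · simpa using h'
    · intro h hh
      simp [hh]
  | @drop i x a hs π h =>
    subst h
    refine ⟨?_, _, List.mem_singleton_self _, rfl, enc_snoc _ _ _, ?_⟩
    · simp only [Cmd.pebNo] at hc
      simp only [List.length_append, List.length_singleton]
      omega
    · intro w hw
      have hw' := (mem_enc hf hx (x := π.length) hc).1 hw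
      simp at hw'
  | @retr x a hs π u h =>
    subst h
    refine ⟨?_, _, List.mem_singleton_self _, rfl, u, enc_snoc _ _ _⟩
    simp only [List.length_append, List.length_singleton] at hx
    simp only
    omega
  | testT h =>
    refine ⟨hx, _, List.mem_cons_self, rfl, rfl, ?_⟩
    simpa using (hT _ _ _ hc hx).2 h
  | testF h =>
    refine ⟨hx, _, List.mem_cons_of_mem _ List.mem_cons_self, rfl, rfl, ?_⟩
    simpa using fun h' => h ((hT _ _ _ hc hx).1 h')

noncomputable def toTWA (rank : Sig → ℕ) (G : Gadget Sig k Bool) (N : ℕ) : TWA Sig rank k where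
  Q := G.Q ⊕ Bool
  finQ := have := G.fin; Fintype.ofFinite _
  X := Fin (N + 1)
  finX := inferInstance
  q0 := Sum.inl G.entry
  acc := {Sum.inr true}
  instr := ⋃ q, (fun p => (Sum.inl q, p.1, p.2)) '' {p | p ∈ (G.prog q).ins (Fin.ofNat (N + 1))}
  instrFin := by
    have := G.fin
    exact Set.finite_iUnion fun q => (List.finite_toSet _).image _

theorem mem_toTWA {G : Gadget Sig k Bool} {N : ℕ} {p : (toTWA rank G N).Q}
    {i : TInstr Sig k (Fin (N + 1))} {a : (toTWA rank G N).Q} :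
    (p, i, a) ∈ (toTWA rank G N).instr ↔ ∃ q, p = Sum.inl q ∧
      (i, a) ∈ (G.prog q).ins (Fin.ofNat (N + 1)) := by
  constructor
  · intro h
    obtain ⟨q, ⟨i', a'⟩, h1, h2⟩ := Set.mem_iUnion.1 h
    obtain ⟨e1, e2⟩ := Prod.mk.inj h2
    obtain ⟨e2, e3⟩ := Prod.mk.inj e2
    simp only at e1 e2 e3
    subst e2 e3
    exact ⟨q, e1.symm, h1⟩
  · rintro ⟨q, rfl, h⟩
    exact Set.mem_iUnion.2 ⟨q, (i, a), h, rfl⟩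

theorem toTWA_det (G : Gadget Sig k Bool) (N : ℕ) : Deterministic (toTWA rank G N) := by
  intro p χ₁ q₁ χ₂ q₂ h1 h2 hne
  obtain ⟨q, rfl, h1'⟩ := mem_toTWA.1 h1
  obtain ⟨q', e, h2'⟩ := mem_toTWA.1 h2
  clear h1 h2
  rename' h1' => h1, h2' => h2
  obtain rfl := Sum.inl.inj e
  generalize G.prog q = c at h1 h2
  cases c with
  | up i a => exact absurd ((List.mem_singleton.1 h1).trans (List.mem_singleton.1 h2).symm) hne
  | down i j a => exact absurd ((List.mem_singleton.1 h1).trans (List.mem_singleton.1 h2).symm) hne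
  | drop i x a => exact absurd ((List.mem_singleton.1 h1).trans (List.mem_singleton.1 h2).symm) hne
  | retr x a => exact absurd ((List.mem_singleton.1 h1).trans (List.mem_singleton.1 h2).symm) hne
  | test τ a b =>
    rcases List.mem_cons.1 h1 with h1 | h1 <;> rcases List.mem_cons.1 h2 with h2 | h2
    · exact absurd (h1.trans h2.symm) hne
    · left
      obtain ⟨rfl, _⟩ := Prod.mk.inj h1
      obtain ⟨rfl, _⟩ := Prod.mk.inj (List.mem_singleton.1 h2)
      exact ⟨true, _, rfl, rfl⟩
    · left
      obtain ⟨rfl, _⟩ := Prod.mk.inj h2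
      obtain ⟨rfl, _⟩ := Prod.mk.inj (List.mem_singleton.1 h1)
      exact ⟨false, _, rfl, rfl⟩
    · exact absurd ((List.mem_singleton.1 h1).trans (List.mem_singleton.1 h2).symm) hne

theorem toTWA_accepts {G : Gadget Sig k Bool} {N : ℕ} (hN : ∀ q, (G.prog q).pebNo ≤ N)
    {t : RTree Sig rank} {b : Bool}
    (h : G.Run t ((fun _ => rootPos t), []) b ((fun _ => rootPos t), [])) :
    Accepts (toTWA rank G N) t ↔ b = true := by
  have hf : ∀ x y, x ≤ N → y ≤ N → Fin.ofNat (N + 1) x = Fin.ofNat (N + 1) y → x = y := by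
    intro x y hx hy hxy
    have := congrArg Fin.val hxy
    simp only [Fin.val_ofNat] at this
    rwa [Nat.mod_eq_of_lt (by omega), Nat.mod_eq_of_lt (by omega)] at this
  have key : ∀ z, Relation.ReflTransGen (GStep G t)
      (Sum.inl G.entry, ((fun _ => rootPos t), [])) z → z.2.2.length ≤ N + 1 ∧
      Relation.ReflTransGen (Step (toTWA rank G N) t) (initConf _ t)
        (z.1, z.2.1, enc (Fin.ofNat (N + 1)) z.2.2) := by
    intro z hz
    induction hz with
    | refl => exact ⟨by simp, .refl⟩
    | tail _ hs ih =>
      cases hs with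
      | @mk q x a y hc =>
        obtain ⟨h1, i, h2, h3⟩ := hc.sim hf (hN q) ih.1
        exact ⟨h1, ih.2.tail ⟨i, mem_toTWA.2 ⟨q, rfl, h2⟩, h3⟩⟩
  have hrun : Relation.ReflTransGen (Step (toTWA rank G N) t) (initConf _ t)
      (Sum.inr b, (fun _ => rootPos t), []) := (key _ h).2
  have hhalt : ∀ b' : Bool,
      HaltingConf (toTWA rank G N) t (Sum.inr b', (fun _ => rootPos t), []) := by
    rintro b' c ⟨i, hm, _⟩
    obtain ⟨q, hq, _⟩ := mem_toTWA.1 hm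
    cases hq
  constructor
  · rintro ⟨q, hq, hr, _⟩
    obtain rfl : q = Sum.inr true := hq
    have hfun : Relator.RightUnique (Step (toTWA rank G N) t) :=
      fun a b c h h' => Step.functional (toTWA_det G N) h h'
    have heq : ∀ b₁ b₂ : Bool, Relation.ReflTransGen (Step (toTWA rank G N) t)
        (Sum.inr b₁, (fun _ => rootPos t), []) (Sum.inr b₂, (fun _ => rootPos t), []) →
        b₁ = b₂ := by
      intro b₁ b₂ h
      rcases Relation.ReflTransGen.cases_head h with h | ⟨c, h, _⟩
      · exact Sum.inr.inj (Prod.mk.inj h).1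
      · exact absurd h (hhalt b₁ c)
    rcases Relation.ReflTransGen.total_of_right_unique hfun hrun hr with h | h
    · exact heq _ _ h
    · exact (heq _ _ h).symm
  · rintro rfl
    exact ⟨Sum.inr true, rfl, hrun, hhalt true⟩

theorem testable_mem_DPTWA {L : Set (RTree Sig rank)}
    (h : Testable k (V := Empty) (fun (t : RTree Sig rank) _ => t ∈ L)) :
    L ∈ DPTWA Sig rank k := by
  obtain ⟨G, hG⟩ := h 0 Empty.elim
  have := G.fin
  obtain ⟨N, hN⟩ := (Set.finite_range fun q => (G.prog q).pebNo).bddAbove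
  refine ⟨toTWA rank G N, toTWA_det G N, Set.ext fun t => ?_⟩
  obtain ⟨b, hb, hr⟩ := hG t [] (fun e => e.elim) rfl (fun e => e.elim)
  refine Iff.trans hb.symm ?_
  exact (toTWA_accepts (fun q => hN ⟨q, rfl⟩) hr).symm

end toTWA

/-- For every ranked alphabet and `k ≥ 1`, the family `DPTWA^k`
is closed under complement (within `T_Σ`) and under union. -/
theorem DPTWA_closed_compl_union (Sig : Type) [Fintype Sig] (rank : Sig → ℕ)
    (k : ℕ) (hk : 1 ≤ k) :
    (∀ L ∈ DPTWA Sig rank k, Lᶜ ∈ DPTWA Sig rank k) ∧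
    (∀ L₁ ∈ DPTWA Sig rank k, ∀ L₂ ∈ DPTWA Sig rank k,
      L₁ ∪ L₂ ∈ DPTWA Sig rank k) := by
  have : NeZero k := ⟨by omega⟩
  constructor
  · rintro L ⟨A, hA, rfl⟩
    exact testable_mem_DPTWA (lang_testable A hA).not
  · rintro L₁ ⟨A, hA, rfl⟩ L₂ ⟨B, hB, rfl⟩
    exact testable_mem_DPTWA ((lang_testable A hA).or (lang_testable B hB))

end NestedPebbles
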